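/- arXiv:math/0207278 — 13 statements merged into one kernel-verified Lean document; each statement's English description precedes it below -/
import Mathlib

section
/- Let A be an algebra over a field F and let P = (P_t)_{t≥0} be a family of F-linear maps of A into itself satisfying P_0 = id and P_{s+t} = P_s ∘ P_t for all s,t ≥ 0. Then there exists a unique family of moment maps for P, i.e. a unique family assigning to every integer k ≥ 1 and every k-tuple (t_1,…,t_k) of nonnegative reals a k-multilinear map (a_1,…,a_k) ↦ [t_1,…,t_k; a_1,…,a_k] from A^k to A such that axioms MP1 and MP2 hold. -/
open scoped NNReal

/-- `IsMomentFamily P M` says that `M` is a family of moment maps for `(A, P)`: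
to every `k ≥ 1` and every `k`-tuple `(t_1, …, t_k)` of nonnegative reals it
assigns a `k`-multilinear map `(a_1, …, a_k) ↦ [t_1,…,t_k; a_1,…,a_k]`
satisfying the axioms MP1 and MP2 (with the convention that empty bracket
factors are omitted).  Here `M k t` is the bracket of length `k + 1` with
time-tuple `t : Fin (k+1) → ℝ≥0`. -/
def IsMomentFamily {F A : Type*} [Field F] [Ring A] [Algebra F A]
    (P : ℝ≥0 → A →ₗ[F] A)
    (M : ∀ k : ℕ, (Fin (k + 1) → ℝ≥0) → MultilinearMap F (fun _ : Fin (k + 1) => A) A) :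
    Prop :=
  -- MP1
  (∀ (k : ℕ) (t : Fin (k + 1) → ℝ≥0) (s : ℝ≥0) (a : Fin (k + 1) → A),
      P s (M k t a) = M k (fun i => t i + s) a) ∧
  -- MP2, singleton case: `[0; a] = a`
  (∀ (t : Fin 1 → ℝ≥0) (a : Fin 1 → A), t 0 = 0 → M 0 t a = a 0) ∧
  -- MP2, zero in the first position
  (∀ (k : ℕ) (t : Fin (k + 1) → ℝ≥0) (c : A) (a : Fin (k + 1) → A),
      M (k + 1) (Fin.cons 0 t) (Fin.cons c a) = c * M k t a) ∧
  -- MP2, zero in the last position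
  (∀ (k : ℕ) (t : Fin (k + 1) → ℝ≥0) (c : A) (a : Fin (k + 1) → A),
      M (k + 1) (Fin.snoc t 0) (Fin.snoc a c) = M k t a * c) ∧
  -- MP2, zero in an interior position
  (∀ (m n : ℕ) (s : Fin (m + 1) → ℝ≥0) (u : Fin (n + 1) → ℝ≥0)
      (a : Fin (m + 1) → A) (c : A) (b : Fin (n + 1) → A),
      M (m + n + 2)
        (Fin.append s (Fin.cons 0 u) ∘
          Fin.cast (show m + n + 2 + 1 = (m + 1) + (n + 1 + 1) by omega))
        (Fin.append a (Fin.cons c b) ∘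
          Fin.cast (show m + n + 2 + 1 = (m + 1) + (n + 1 + 1) by omega)) =
      M m s a * c * M n u b)

/-- The first index below `n` at which `t` attains its minimum over `{0, …, n - 1}`. -/
noncomputable def argminBelow (t : ℕ → ℝ≥0) (n : ℕ) : ℕ :=
  sInf {p | p < n ∧ ∀ i < n, t p ≤ t i}

theorem argminBelow_mem (t : ℕ → ℝ≥0) (n : ℕ) :
    argminBelow t (n + 1) < n + 1 ∧ ∀ i < n + 1, t (argminBelow t (n + 1)) ≤ t i := by
  refine Nat.sInf_mem (s := {p | p < n + 1 ∧ ∀ i < n + 1, t p ≤ t i}) ?_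
  obtain ⟨p, hp, h⟩ := Finset.exists_min_image (Finset.range (n + 1)) t ⟨0, by simp⟩
  exact ⟨p, by simpa using hp, fun i hi => h i (by simpa using hi)⟩

theorem argminBelow_lt (t : ℕ → ℝ≥0) (n : ℕ) : argminBelow t (n + 1) < n + 1 :=
  (argminBelow_mem t n).1

theorem argminBelow_congr {t t' : ℕ → ℝ≥0} {n : ℕ} (h : ∀ i < n, t i = t' i) :
    argminBelow t n = argminBelow t' n := by
  unfold argminBelow
  congr 1
  ext p
  refine and_congr_right fun hp => forall₂_congr fun i hi => ?_
  rw [h p hp, h i hi]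

theorem argminBelow_add (t : ℕ → ℝ≥0) (n : ℕ) (s : ℝ≥0) :
    argminBelow (fun i => t i + s) n = argminBelow t n := by
  simp [argminBelow]

section

variable {F A : Type*} [Field F] [Ring A] [Algebra F A]

/-- The moment bracket `[t 0, …, t (n - 1); a 0, …, a (n - 1)]`, equal to `1` for `n = 0`. It is
computed by splitting at the first index where the time is minimal. -/
noncomputable def momentBracket (P : ℝ≥0 → A →ₗ[F] A) : ℕ → (ℕ → ℝ≥0) → (ℕ → A) → A
  | 0, _, _ => 1
  | n + 1, t, a =>
    P (t (argminBelow t (n + 1)))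
      (momentBracket P (argminBelow t (n + 1)) (fun i => t i - t (argminBelow t (n + 1))) a *
        a (argminBelow t (n + 1)) *
        momentBracket P (n - argminBelow t (n + 1))
          (fun i => t (argminBelow t (n + 1) + 1 + i) - t (argminBelow t (n + 1)))
          (fun i => a (argminBelow t (n + 1) + 1 + i)))
termination_by n => n
decreasing_by
  · exact argminBelow_lt t n
  · exact Nat.lt_succ_of_le (Nat.sub_le _ _)

variable {P : ℝ≥0 → A →ₗ[F] A}

theorem momentBracket_congr {n : ℕ} {t t' : ℕ → ℝ≥0} {a a' : ℕ → A}
    (ht : ∀ i < n, t i = t' i) (ha : ∀ i < n, a i = a' i) :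
    momentBracket P n t a = momentBracket P n t' a' := by
  induction n using Nat.strong_induction_on generalizing t t' a a' with
  | _ n ih =>
    cases n with
    | zero => simp [momentBracket]
    | succ n =>
      have hp := argminBelow_lt t' n
      rw [momentBracket, momentBracket, argminBelow_congr ht]
      generalize argminBelow t' (n + 1) = p at hp
      rw [ht p hp, ha p hp]
      congr 2
      · congr 1
        exact ih p hp (fun i hi => by rw [ht i (by omega)]) (fun i hi => ha i (by omega))
      · exact ih (n - p) (by omega) (fun i hi => by rw [ht _ (by omega)])
          (fun i hi => ha _ (by omega))

theorem momentBracket_add (hPmul : ∀ s t : ℝ≥0, P (s + t) = (P s).comp (P t))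
    (n : ℕ) (t : ℕ → ℝ≥0) (s : ℝ≥0) (a : ℕ → A) :
    P s (momentBracket P (n + 1) t a) = momentBracket P (n + 1) (fun i => t i + s) a := by
  have hadd (r : ℝ≥0) (x : A) : P (r + s) x = P s (P r x) := by
    rw [add_comm, hPmul, LinearMap.comp_apply]
  rw [momentBracket, momentBracket, argminBelow_add, hadd]
  simp only [add_tsub_add_eq_tsub_right]

theorem momentBracket_split (hP0 : P 0 = LinearMap.id) {n p q : ℕ} (hn : n = p + q + 1)
    {t : ℕ → ℝ≥0} (hp : t p = 0) (a : ℕ → A) :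
    momentBracket P n t a = momentBracket P p t a * a p *
      momentBracket P q (fun i => t (p + 1 + i)) (fun i => a (p + 1 + i)) := by
  induction n using Nat.strong_induction_on generalizing t a p q with
  | _ n ih =>
    subst hn
    obtain ⟨hlt, hle⟩ := argminBelow_mem t (p + q)
    rw [momentBracket]
    generalize argminBelow t (p + q + 1) = r at hlt hle
    have hr : t r = 0 := le_antisymm (hp ▸ hle p (by omega)) zero_le
    simp only [hr, hP0, LinearMap.id_apply, tsub_zero]
    rcases lt_trichotomy p r with h | rfl | h
    · obtain ⟨j, rfl⟩ := Nat.exists_eq_add_of_lt h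
      obtain ⟨l, rfl⟩ : ∃ l, q = j + l + 1 := ⟨q - (j + 1), by omega⟩
      have hidx : p + 1 + j = p + j + 1 := by omega
      have hidx' (i : ℕ) : p + 1 + (j + 1 + i) = p + j + 1 + 1 + i := by omega
      rw [ih (p + j + 1) (by omega) rfl hp,
        ih (j + l + 1) (by omega) rfl (t := fun i => t (p + 1 + i)) (by rw [hidx, hr]),
        show p + (j + l + 1) - (p + j + 1) = l by omega]
      simp only [mul_assoc, hidx, hidx']
    · simp
    · obtain ⟨j, rfl⟩ := Nat.exists_eq_add_of_lt h
      have hidx : r + 1 + j = r + j + 1 := by omega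
      have hidx' (i : ℕ) : r + 1 + (j + 1 + i) = r + j + 1 + 1 + i := by omega
      rw [ih (r + j + 1) (by omega) rfl hr, show r + j + 1 + q - r = j + q + 1 by omega,
        ih (j + q + 1) (by omega) rfl (t := fun i => t (r + 1 + i)) (by rw [hidx, hp])]
      simp only [mul_assoc, hidx, hidx']

theorem momentBracket_linear {n q : ℕ} (hq : q < n) (t : ℕ → ℝ≥0) {a b e : ℕ → A} {x y : F}
    (hb : ∀ i < n, i ≠ q → a i = b i) (he : ∀ i < n, i ≠ q → a i = e i)
    (h : a q = x • b q + y • e q) :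
    momentBracket P n t a = x • momentBracket P n t b + y • momentBracket P n t e := by
  induction n using Nat.strong_induction_on generalizing t a b e q with
  | _ n ih =>
    cases n with
    | zero => omega
    | succ n =>
      have hp := argminBelow_lt t n
      simp only [momentBracket]
      generalize argminBelow t (n + 1) = p at hp
      simp only [← map_smul, ← map_add]
      congr 1
      have left {f : ℕ → A} (hf : ∀ i < n + 1, i ≠ q → a i = f i) (hpq : p ≤ q) :
          momentBracket P p (fun i => t i - t p) a = momentBracket P p (fun i => t i - t p) f :=
        momentBracket_congr (fun _ _ => rfl) (fun i hi => hf i (by omega) (by omega))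
      have right {f : ℕ → A} (hf : ∀ i < n + 1, i ≠ q → a i = f i) (hpq : q ≤ p) :
          momentBracket P (n - p) (fun i => t (p + 1 + i) - t p) (fun i => a (p + 1 + i)) =
            momentBracket P (n - p) (fun i => t (p + 1 + i) - t p) (fun i => f (p + 1 + i)) :=
        momentBracket_congr (fun _ _ => rfl) (fun i hi => hf _ (by omega) (by omega))
      rcases lt_trichotomy q p with hpq | rfl | hpq
      · rw [← right hb hpq.le, ← right he hpq.le, ← hb p hp hpq.ne', ← he p hp hpq.ne',
          ih p hp hpq _ (fun i hi => hb i (by omega)) (fun i hi => he i (by omega)) h]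
        simp only [add_mul, smul_mul_assoc]
      · rw [← right hb le_rfl, ← right he le_rfl, ← left hb le_rfl, ← left he le_rfl, h]
        simp only [add_mul, mul_add, smul_mul_assoc, mul_smul_comm]
      · obtain ⟨j, rfl⟩ := Nat.exists_eq_add_of_lt hpq
        rw [← left hb hpq.le, ← left he hpq.le, ← hb p hp hpq.ne, ← he p hp hpq.ne,
          ih (n - p) (by omega) (q := j) (by omega) _
            (b := fun i => b (p + 1 + i)) (e := fun i => e (p + 1 + i))
            (fun i hi hij => hb _ (by omega) (by omega))
            (fun i hi hij => he _ (by omega) (by omega))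
            (by rwa [show p + 1 + j = p + j + 1 by omega])]
        simp only [mul_add, mul_smul_comm]

/-- Extension of a tuple by zero to a sequence. -/
def extendZero {α : Type*} [Zero α] {n : ℕ} (f : Fin n → α) (i : ℕ) : α :=
  if h : i < n then f ⟨i, h⟩ else 0

@[simp]
theorem extendZero_val {α : Type*} [Zero α] {n : ℕ} (f : Fin n → α) (i : Fin n) :
    extendZero f i = f i := by
  simp [extendZero]

theorem extendZero_of_lt {α : Type*} [Zero α] {n : ℕ} (f : Fin n → α) {i : ℕ} (h : i < n) :
    extendZero f i = f ⟨i, h⟩ := by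
  simp [extendZero, h]

theorem extendZero_update {n : ℕ} [DecidableEq (Fin n)] (a : Fin n → A) (q : Fin n) (z : A)
    {i : ℕ} (hi : i < n) (hne : i ≠ q) :
    extendZero (Function.update a q z) i = extendZero a i := by
  rw [extendZero_of_lt _ hi, extendZero_of_lt _ hi, Function.update_of_ne]
  simpa [Fin.ext_iff] using hne

theorem extendZero_cons_add {α : Type*} [Zero α] {n : ℕ} (c : α) (f : Fin n → α) (i : ℕ) :
    extendZero (Fin.cons c f : Fin (n + 1) → α) (1 + i) = extendZero f i := by
  rw [add_comm 1 i]
  by_cases h : i < n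
  · rw [extendZero_of_lt _ h, extendZero_of_lt _ (Nat.succ_lt_succ h)]
    exact Fin.cons_succ (α := fun _ => α) c f ⟨i, h⟩
  · simp [extendZero, h]

theorem extendZero_append_of_lt {α : Type*} [Zero α] {k m n : ℕ} (h : k = m + n)
    (f : Fin m → α) (g : Fin n → α) {i : ℕ} (hi : i < m) :
    extendZero (Fin.append f g ∘ Fin.cast h) i = extendZero f i := by
  subst h
  rw [extendZero_of_lt _ hi, extendZero_of_lt _ (by omega)]
  exact Fin.append_left f g ⟨i, hi⟩

theorem extendZero_append_add {α : Type*} [Zero α] {k m n : ℕ} (h : k = m + n)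
    (f : Fin m → α) (g : Fin n → α) (i : ℕ) :
    extendZero (Fin.append f g ∘ Fin.cast h) (m + i) = extendZero g i := by
  subst h
  by_cases hi : i < n
  · rw [extendZero_of_lt _ hi, extendZero_of_lt _ (by omega)]
    exact Fin.append_right f g ⟨i, hi⟩
  · simp [extendZero, hi]

theorem restrict_eq_cons {α : Type*} (n : ℕ) (f : ℕ → α) :
    (fun i : Fin (n + 1) => f i) = Fin.cons (f 0) (fun i : Fin n => f (0 + 1 + i)) := by
  funext i
  refine Fin.cases rfl (fun i => ?_) i
  simp [add_comm]

theorem restrict_eq_snoc {α : Type*} (n : ℕ) (f : ℕ → α) :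
    (fun i : Fin (n + 1) => f i) = Fin.snoc (fun i : Fin n => f i) (f n) := by
  funext i
  refine Fin.lastCases ?_ (fun i => ?_) i <;> simp

theorem restrict_eq_append {α : Type*} {k m n : ℕ} (h : k = m + (n + 1)) (f : ℕ → α) :
    (fun i : Fin k => f i) =
      Fin.append (fun i : Fin m => f i)
        (Fin.cons (f m) (fun i : Fin n => f (m + 1 + i)) : Fin (n + 1) → α) ∘ Fin.cast h := by
  subst h
  funext i
  refine Fin.addCases (fun i => ?_) (fun i => ?_) i
  · simp
  · refine Fin.cases (by simp) (fun i => ?_) i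
    simp [add_assoc, add_comm 1]

/-- The moment bracket of a fixed tuple of times, as a multilinear map. -/
noncomputable def momentMap (P : ℝ≥0 → A →ₗ[F] A) (k : ℕ) (t : Fin (k + 1) → ℝ≥0) :
    MultilinearMap F (fun _ : Fin (k + 1) => A) A where
  toFun a := momentBracket P (k + 1) (extendZero t) (extendZero a)
  map_update_add' a q u v := by
    have := momentBracket_linear (P := P) q.isLt (extendZero t)
      (a := extendZero (Function.update a q (u + v))) (b := extendZero (Function.update a q u))
      (e := extendZero (Function.update a q v)) (x := 1) (y := 1)
      (fun i hi hne => by rw [extendZero_update _ _ _ hi hne, extendZero_update _ _ _ hi hne])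
      (fun i hi hne => by rw [extendZero_update _ _ _ hi hne, extendZero_update _ _ _ hi hne])
      (by simp)
    simpa using this
  map_update_smul' a q c u := by
    have := momentBracket_linear (P := P) q.isLt (extendZero t)
      (a := extendZero (Function.update a q (c • u))) (b := extendZero (Function.update a q u))
      (e := extendZero (Function.update a q u)) (x := c) (y := 0)
      (fun i hi hne => by rw [extendZero_update _ _ _ hi hne, extendZero_update _ _ _ hi hne])
      (fun i hi hne => by rw [extendZero_update _ _ _ hi hne, extendZero_update _ _ _ hi hne])
      (by simp)
    simpa using this

theorem momentMap_apply (P : ℝ≥0 → A →ₗ[F] A) (k : ℕ) (t : Fin (k + 1) → ℝ≥0)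
    (a : Fin (k + 1) → A) :
    momentMap P k t a = momentBracket P (k + 1) (extendZero t) (extendZero a) :=
  rfl

theorem isMomentFamily_momentMap (hP0 : P 0 = LinearMap.id)
    (hPmul : ∀ s t : ℝ≥0, P (s + t) = (P s).comp (P t)) :
    IsMomentFamily P (momentMap P) := by
  refine ⟨fun k t s a => ?_, fun t a h => ?_, fun k t c a => ?_, fun k t c a => ?_,
    fun m n s u a c b => ?_⟩
  · rw [momentMap_apply, momentMap_apply, momentBracket_add hPmul]
    exact momentBracket_congr (fun i hi => by simp [extendZero_of_lt, hi]) fun _ _ => rfl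
  · rw [momentMap_apply, momentBracket_split hP0 (p := 0) (q := 0) rfl
      (by simpa [extendZero] using h)]
    simp [momentBracket, extendZero]
  · rw [momentMap_apply, momentBracket_split hP0 (p := 0) (q := k + 1) (by omega)
      (by simp [extendZero])]
    simp only [momentBracket.eq_1, one_mul, momentMap_apply]
    congr 1
    simp only [zero_add, extendZero_cons_add]
  · rw [momentMap_apply, momentBracket_split hP0 (p := k + 1) (q := 0) (by omega)
      (by simp [extendZero, Fin.snoc])]
    simp only [momentBracket.eq_1, mul_one, momentMap_apply]
    congr 1
    · refine momentBracket_congr (fun i hi => ?_) (fun i hi => ?_) <;>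
        simp [extendZero, Fin.snoc, hi, hi.trans (Nat.lt_succ_self _)]
    · simp [extendZero, Fin.snoc]
  · have hzero : extendZero (Fin.append s (Fin.cons 0 u) ∘
        Fin.cast (show m + n + 2 + 1 = (m + 1) + (n + 1 + 1) by omega)) (m + 1) = 0 := by
      simpa [extendZero] using extendZero_append_add
        (show m + n + 2 + 1 = (m + 1) + (n + 1 + 1) by omega) s (Fin.cons 0 u) 0
    have hmid : extendZero (Fin.append a (Fin.cons c b) ∘
        Fin.cast (show m + n + 2 + 1 = (m + 1) + (n + 1 + 1) by omega)) (m + 1) = c := by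
      simpa [extendZero] using extendZero_append_add
        (show m + n + 2 + 1 = (m + 1) + (n + 1 + 1) by omega) a (Fin.cons c b) 0
    rw [momentMap_apply, momentBracket_split hP0 (p := m + 1) (q := n + 1) (by omega) hzero, hmid]
    simp only [add_assoc (m + 1) 1, extendZero_append_add, extendZero_cons_add, momentMap_apply]
    congr 2
    exact momentBracket_congr (fun i hi => extendZero_append_of_lt _ _ _ hi)
      (fun i hi => extendZero_append_of_lt _ _ _ hi)

theorem IsMomentFamily.eq_momentBracket
    {M : ∀ k : ℕ, (Fin (k + 1) → ℝ≥0) → MultilinearMap F (fun _ : Fin (k + 1) => A) A}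
    (hM : IsMomentFamily P M) (k : ℕ) (t : ℕ → ℝ≥0) (a : ℕ → A) :
    M k (fun i => t i) (fun i => a i) = momentBracket P (k + 1) t a := by
  obtain ⟨hshift, hone, hcons, hsnoc, happend⟩ := hM
  induction k using Nat.strong_induction_on generalizing t a with
  | _ k ih =>
    obtain ⟨hlt, hle⟩ := argminBelow_mem t k
    rw [momentBracket]
    generalize argminBelow t (k + 1) = p at hlt hle
    have hM : M k (fun i => t i) (fun i => a i) =
        P (t p) (M k (fun i => t i - t p) (fun i => a i)) := by
      rw [hshift]
      congr 2
      funext i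
      exact (tsub_add_cancel_of_le (hle i i.isLt)).symm
    rw [hM]
    congr 1
    have hp : t p - t p = 0 := tsub_self _
    rcases p with _ | m
    · rcases k with _ | k
      · rw [hone _ _ hp]
        simp [momentBracket]
      · rw [restrict_eq_cons (k + 1) (fun i => t i - t 0), restrict_eq_cons (k + 1) a, hp, hcons,
          Nat.sub_zero, ← ih k (by omega)]
        simp [momentBracket]
    · obtain rfl | ⟨n, rfl⟩ : k = m + 1 ∨ ∃ n, k = m + n + 2 := by
        rcases eq_or_ne k (m + 1) with h | h
        · exact Or.inl h
        · exact Or.inr ⟨k - m - 2, by omega⟩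
      · rw [restrict_eq_snoc (m + 1) (fun i => t i - t (m + 1)), restrict_eq_snoc (m + 1) a, hp,
          hsnoc, ← ih m (by omega)]
        simp [momentBracket]
      · have h : m + n + 2 + 1 = (m + 1) + (n + 1 + 1) := by omega
        rw [restrict_eq_append h (fun i => t i - t (m + 1)), restrict_eq_append h a, hp, happend,
          show m + n + 2 - (m + 1) = n + 1 by omega, ← ih m (by omega), ← ih n (by omega)]

end

/-- **Existence and uniqueness of moment polynomials.**  If `A` is an algebra
over a field `F` and `P = (P_t)_{t ≥ 0}` is a family of linear maps of `A`
into itself with `P_0 = id` and `P_{s+t} = P_s ∘ P_t`, then there is a unique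
family of moment maps for `P`, i.e. a unique family of multilinear maps
indexed by tuples of nonnegative reals satisfying MP1 and MP2. -/
theorem momentFamily_existsUnique {F A : Type*} [Field F] [Ring A] [Algebra F A]
    (P : ℝ≥0 → A →ₗ[F] A) (hP0 : P 0 = LinearMap.id)
    (hPmul : ∀ s t : ℝ≥0, P (s + t) = (P s).comp (P t)) :
    ∃! M : ∀ k : ℕ, (Fin (k + 1) → ℝ≥0) → MultilinearMap F (fun _ : Fin (k + 1) => A) A,
      IsMomentFamily P M := by
  refine ⟨momentMap P, isMomentFamily_momentMap hP0 hPmul, fun M hM => ?_⟩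
  funext k t
  ext a
  rw [momentMap_apply, ← hM.eq_momentBracket]
  simp
end

section
/- Let A be an algebra over a field F equipped with an involution a ↦ a* (additive, anti-multiplicative, with a** = a), let P = (P_t)_{t≥0} be a family of linear maps of A into itself with P_0 = id, P_{s+t} = P_s ∘ P_t, and P_t(a)* = P_t(a*) for all t ≥ 0 and a ∈ A. Then the moment maps of P satisfy the symmetry relation [t_1,…,t_k; a_1,…,a_k]* = [t_k,…,t_1; a_k*,…,a_1*] for every k ≥ 1, all t_1,…,t_k ≥ 0 and all a_1,…,a_k ∈ A. -/
open scoped NNReal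

namespace IsMomentFamily

variable {F A : Type*} [Field F] [Ring A] [Algebra F A] {P : ℝ≥0 → A →ₗ[F] A}
  {M : ∀ k : ℕ, (Fin (k + 1) → ℝ≥0) → MultilinearMap F (fun _ : Fin (k + 1) => A) A}

theorem apply_of_zero_eq_zero (hM : IsMomentFamily P M) {k : ℕ} (t : Fin (k + 2) → ℝ≥0)
    (a : Fin (k + 2) → A) (ht : t 0 = 0) :
    M (k + 1) t a = a 0 * M k (fun i => t i.succ) (fun i => a i.succ) := by
  have h := hM.2.2.1 k (Fin.tail t) (a 0) (Fin.tail a)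
  rw [← ht, Fin.cons_self_tail, Fin.cons_self_tail] at h
  exact h

theorem apply_of_last_eq_zero (hM : IsMomentFamily P M) {k : ℕ} (t : Fin (k + 2) → ℝ≥0)
    (a : Fin (k + 2) → A) (ht : t (Fin.last (k + 1)) = 0) :
    M (k + 1) t a = M k (fun i => t i.castSucc) (fun i => a i.castSucc) * a (Fin.last _) := by
  have h := hM.2.2.2.1 k (Fin.init t) (a (Fin.last _)) (Fin.init a)
  rw [← ht, Fin.snoc_init_self, Fin.snoc_init_self] at h
  exact h

/-- A tuple of length `m + n + 3` is the concatenation of its first `m + 1` entries,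
its entry at position `m + 1`, and its last `n + 1` entries. -/
theorem append_cons_slices {X : Type*} (m n : ℕ) (f : Fin (m + n + 2 + 1) → X) :
    Fin.append (fun i : Fin (m + 1) => f ⟨i, by omega⟩)
        (Fin.cons (f ⟨m + 1, by omega⟩) fun i : Fin (n + 1) => f ⟨m + 2 + i, by omega⟩) ∘
      Fin.cast (show m + n + 2 + 1 = (m + 1) + (n + 1 + 1) by omega) = f := by
  suffices h : ∀ j : Fin ((m + 1) + (n + 1 + 1)),
      Fin.append (fun i : Fin (m + 1) => f ⟨i, by omega⟩)
        (Fin.cons (f ⟨m + 1, by omega⟩) fun i : Fin (n + 1) => f ⟨m + 2 + i, by omega⟩) j =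
      f ⟨j, by omega⟩ from funext fun i => h (Fin.cast (by omega) i)
  intro j
  refine Fin.addCases (fun i => ?_) (fun i => ?_) j
  · simp
  · rw [Fin.append_right]
    refine Fin.cases ?_ (fun i => ?_) i
    · simp
    · simp only [Fin.cons_succ]
      congr 2
      simp only [Fin.val_natAdd, Fin.val_succ]
      omega

theorem apply_of_interior_eq_zero (hM : IsMomentFamily P M) {k m n : ℕ} (hk : k = m + n + 2)
    (t : Fin (k + 1) → ℝ≥0) (a : Fin (k + 1) → A) (ht : t ⟨m + 1, by omega⟩ = 0) :
    M k t a =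
      M m (fun i => t ⟨i, by omega⟩) (fun i => a ⟨i, by omega⟩) * a ⟨m + 1, by omega⟩ *
        M n (fun i => t ⟨m + 2 + i, by omega⟩) (fun i => a ⟨m + 2 + i, by omega⟩) := by
  subst hk
  have h := hM.2.2.2.2 m n (fun i => t ⟨i, by omega⟩) (fun i => t ⟨m + 2 + i, by omega⟩)
    (fun i => a ⟨i, by omega⟩) (a ⟨m + 1, by omega⟩) (fun i => a ⟨m + 2 + i, by omega⟩)
  rw [← ht, append_cons_slices, append_cons_slices] at h
  exact h

/-- Every bracket is the image under some `P s` of a bracket with a vanishing time. -/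
theorem exists_shift (hM : IsMomentFamily P M) {k : ℕ} (t : Fin (k + 1) → ℝ≥0) :
    ∃ (s : ℝ≥0) (u : Fin (k + 1) → ℝ≥0), (∃ l, u l = 0) ∧ (∀ i, t i = u i + s) ∧
      ∀ a, M k t a = P s (M k u a) := by
  obtain ⟨l, hl⟩ := Finite.exists_min t
  have hu : ∀ i, t i = (t i - t l) + t l := fun i => (tsub_add_cancel_of_le (hl i)).symm
  refine ⟨t l, fun i => t i - t l, ⟨l, tsub_self _⟩, hu, fun a => ?_⟩
  rw [hM.1]
  congr 1
  exact congrArg _ (funext hu)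

/-- The symmetry relation for a bracket with a vanishing time, given the relation for all
shorter brackets. -/
theorem star_apply_of_eq_zero [StarRing A] (hM : IsMomentFamily P M) {k : ℕ}
    (ih : ∀ j < k, ∀ (t : Fin (j + 1) → ℝ≥0) (a : Fin (j + 1) → A),
      star (M j t a) = M j (fun i => t i.rev) (fun i => star (a i.rev)))
    (t : Fin (k + 1) → ℝ≥0) (a : Fin (k + 1) → A) (l : Fin (k + 1)) (hl : t l = 0) :
    star (M k t a) = M k (fun i => t i.rev) (fun i => star (a i.rev)) := by
  rcases k with _ | k
  · obtain rfl : l = 0 := Fin.ext (by omega)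
    rw [hM.2.1 t a hl, hM.2.1 _ _ (by simpa using hl)]
    simp
  by_cases h0 : l = 0
  · subst h0
    rw [hM.apply_of_zero_eq_zero t a hl, hM.apply_of_last_eq_zero _ _ (by simpa using hl),
      star_mul, ih k (Nat.lt_succ_self k)]
    simp [Fin.rev_castSucc]
  by_cases h1 : l = Fin.last (k + 1)
  · subst h1
    rw [hM.apply_of_last_eq_zero t a hl, hM.apply_of_zero_eq_zero _ _ (by simpa using hl),
      star_mul, ih k (Nat.lt_succ_self k)]
    simp [Fin.rev_succ]
  obtain ⟨l, hlk⟩ := l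
  simp only [Fin.ext_iff, Fin.val_zero, Fin.val_last] at h0 h1
  obtain ⟨m, rfl⟩ : ∃ m, l = m + 1 := ⟨l - 1, by omega⟩
  obtain ⟨n, hn⟩ : ∃ n, k + 1 = m + n + 2 := ⟨k - m - 1, by omega⟩
  have hrev : (⟨n + 1, by omega⟩ : Fin (k + 1 + 1)).rev = ⟨m + 1, hlk⟩ := by
    ext
    simp only [Fin.val_rev]
    omega
  have hhead : ∀ i : Fin (n + 1), (⟨i, by omega⟩ : Fin (k + 1 + 1)).rev =
      ⟨m + 2 + i.rev, by omega⟩ := by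
    intro i
    ext
    simp only [Fin.val_rev]
    omega
  have htail : ∀ i : Fin (m + 1), (⟨n + 2 + i, by omega⟩ : Fin (k + 1 + 1)).rev =
      ⟨i.rev, by omega⟩ := by
    intro i
    ext
    simp only [Fin.val_rev]
    omega
  rw [hM.apply_of_interior_eq_zero hn t a hl,
    hM.apply_of_interior_eq_zero (hn.trans (by omega : _ = n + m + 2)) _ _ (by rw [hrev, hl]),
    star_mul, star_mul, ih m (by omega), ih n (by omega), ← mul_assoc]
  simp only [hrev, hhead, htail]

end IsMomentFamily

/-- **Symmetry of moment polynomials.**  If `A` is an algebra over a field `F`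
carrying an involution `a ↦ a⋆` (additive, anti-multiplicative, involutive),
and `P = (P_t)_{t ≥ 0}` is a semigroup of linear maps of `A` with `P_0 = id`,
`P_{s+t} = P_s ∘ P_t` and `P_t(a)⋆ = P_t(a⋆)`, then the moment maps of `P`
satisfy `[t_1,…,t_k; a_1,…,a_k]⋆ = [t_k,…,t_1; a_k⋆,…,a_1⋆]`. -/
theorem momentFamily_star_symmetry {F A : Type*} [Field F] [Ring A] [Algebra F A]
    [StarRing A]
    (P : ℝ≥0 → A →ₗ[F] A) (hP0 : P 0 = LinearMap.id)
    (hPmul : ∀ s t : ℝ≥0, P (s + t) = (P s).comp (P t))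
    (hPstar : ∀ (t : ℝ≥0) (a : A), star (P t a) = P t (star a))
    (M : ∀ k : ℕ, (Fin (k + 1) → ℝ≥0) → MultilinearMap F (fun _ : Fin (k + 1) => A) A)
    (hM : IsMomentFamily P M) :
    ∀ (k : ℕ) (t : Fin (k + 1) → ℝ≥0) (a : Fin (k + 1) → A),
      star (M k t a) = M k (fun i => t i.rev) (fun i => star (a i.rev)) := by
  intro k
  induction k using Nat.strong_induction_on with
  | _ k ih =>
    intro t a
    obtain ⟨s, u, ⟨l, hl⟩, htu, hs⟩ := hM.exists_shift t
    rw [hs, hPstar, hM.star_apply_of_eq_zero ih u a l hl, hM.1]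
    simp only [htu]
end

section
/- Let A be a normed algebra over ℝ or ℂ (so that ‖ab‖ ≤ ‖a‖·‖b‖) and let P = (P_t)_{t≥0} be a family of linear maps of A into itself with P_0 = id, P_{s+t} = P_s ∘ P_t, and ‖P_t(a)‖ ≤ ‖a‖ for all t ≥ 0 and a ∈ A. Then any family of moment maps for P satisfies ‖[t_1,…,t_k; a_1,…,a_k]‖ ≤ ‖a_1‖·‖a_2‖⋯‖a_k‖ for all k ≥ 1, t_1,…,t_k ≥ 0 and a_1,…,a_k ∈ A. -/
open scoped NNReal

/-- A tuple of length `m + n + 3` is the concatenation of its first `m + 1` entries, its entry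
at position `m + 1`, and its last `n + 1` entries. -/
theorem exists_eq_append_cons {X : Type*} (m n : ℕ) (f : Fin (m + n + 2 + 1) → X)
    (h : m + n + 2 + 1 = (m + 1) + (n + 1 + 1)) :
    ∃ (a : Fin (m + 1) → X) (b : Fin (n + 1) → X),
      f = Fin.append a (Fin.cons (f ⟨m + 1, by omega⟩) b : Fin (n + 1 + 1) → X) ∘ Fin.cast h := by
  refine ⟨fun i => f (Fin.cast h.symm (Fin.castAdd _ i)),
    fun j => f (Fin.cast h.symm (Fin.natAdd _ j.succ)), ?_⟩
  funext i
  obtain ⟨j, rfl⟩ : ∃ j, i = Fin.cast h.symm j := ⟨Fin.cast h i, rfl⟩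
  induction j using Fin.addCases with
  | left j => simp
  | right j =>
    refine Fin.cases ?_ (fun j => ?_) j
    · simp only [Function.comp_apply, Fin.cast_cast, Fin.cast_eq_self, Fin.append_right,
        Fin.cons_zero]
      rfl
    · simp

/-- The product of the norms of a concatenated tuple. -/
theorem prod_norm_append_cons {A : Type*} [NormedRing A] {m n k : ℕ}
    (h : k = (m + 1) + (n + 1 + 1)) (a : Fin (m + 1) → A) (c : A) (b : Fin (n + 1) → A) :
    ∏ i, ‖(Fin.append a (Fin.cons c b : Fin (n + 1 + 1) → A) ∘ Fin.cast h) i‖ =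
      (∏ i, ‖a i‖) * ‖c‖ * ∏ i, ‖b i‖ := by
  subst h
  simp [Fin.prod_univ_add, Fin.prod_univ_succ (n := n + 1), mul_assoc]

/-- If the norm bound holds for all shorter brackets, then it holds for a bracket one of whose
times vanishes. -/
theorem IsMomentFamily.norm_le_of_time_eq_zero {F A : Type*} [Field F] [NormedRing A] [Algebra F A]
    {P : ℝ≥0 → A →ₗ[F] A}
    {M : ∀ k : ℕ, (Fin (k + 1) → ℝ≥0) → MultilinearMap F (fun _ : Fin (k + 1) => A) A}
    (hM : IsMomentFamily P M) {k : ℕ}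
    (ih : ∀ j < k, ∀ (t : Fin (j + 1) → ℝ≥0) (a : Fin (j + 1) → A), ‖M j t a‖ ≤ ∏ i, ‖a i‖)
    (t : Fin (k + 1) → ℝ≥0) (a : Fin (k + 1) → A) (l : Fin (k + 1)) (hl : t l = 0) :
    ‖M k t a‖ ≤ ∏ i, ‖a i‖ := by
  obtain ⟨-, h_single, h_first, h_last, h_middle⟩ := hM
  rcases k with _ | k
  · obtain rfl : l = 0 := Fin.fin_one_eq_zero l
    simp [h_single t a hl]
  rcases Fin.eq_zero_or_eq_succ l with rfl | ⟨l', rfl⟩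
  · rw [← Fin.cons_self_tail t, ← Fin.cons_self_tail a, hl, h_first, Fin.prod_univ_succ]
    simp only [Fin.cons_zero, Fin.cons_succ]
    refine (norm_mul_le _ _).trans ?_
    gcongr
    exact ih k k.lt_succ_self _ _
  obtain ⟨m, hm⟩ := l'
  rcases Nat.lt_succ_iff_lt_or_eq.mp hm with hlt | rfl
  · obtain ⟨n, rfl⟩ : ∃ n, k = m + n + 1 := ⟨k - m - 1, by omega⟩
    have h : m + n + 2 + 1 = (m + 1) + (n + 1 + 1) := by omega
    obtain ⟨s, u, ht⟩ := exists_eq_append_cons m n t h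
    obtain ⟨b, d, ha⟩ := exists_eq_append_cons m n a h
    rw [show t ⟨m + 1, by omega⟩ = 0 from hl] at ht
    generalize a ⟨m + 1, by omega⟩ = c at ha
    subst ht ha
    calc _ = ‖M m s b * c * M n u d‖ := congrArg norm (h_middle m n s u b c d)
      _ ≤ ‖M m s b‖ * ‖c‖ * ‖M n u d‖ := norm_mul₃_le
      _ ≤ (∏ i, ‖b i‖) * ‖c‖ * ∏ i, ‖d i‖ := by
        gcongr
        · exact ih m (by omega) s b
        · exact ih n (by omega) u d
      _ = _ := (prod_norm_append_cons h b c d).symm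
  · have hl : t (Fin.last _) = 0 := hl
    rw [← Fin.snoc_init_self t, ← Fin.snoc_init_self a, hl, h_last, Fin.prod_univ_castSucc]
    simp only [Fin.snoc_last, Fin.snoc_castSucc]
    refine (norm_mul_le _ _).trans ?_
    gcongr
    exact ih m m.lt_succ_self _ _

/-- **Norm bound for moment polynomials.**  If `A` is a normed algebra over
`ℝ` or `ℂ` (so that `‖ab‖ ≤ ‖a‖·‖b‖`), and `P = (P_t)_{t ≥ 0}` is a semigroup
of linear contractions of `A` with `P_0 = id`, then any family of moment maps
for `P` satisfies `‖[t_1,…,t_k; a_1,…,a_k]‖ ≤ ‖a_1‖⋯‖a_k‖`. -/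
theorem momentFamily_norm_le {𝕜 A : Type*} [RCLike 𝕜] [NormedRing A] [NormedAlgebra 𝕜 A]
    (P : ℝ≥0 → A →ₗ[𝕜] A) (hP0 : P 0 = LinearMap.id)
    (hPmul : ∀ s t : ℝ≥0, P (s + t) = (P s).comp (P t))
    (hPcontr : ∀ (t : ℝ≥0) (a : A), ‖P t a‖ ≤ ‖a‖)
    (M : ∀ k : ℕ, (Fin (k + 1) → ℝ≥0) → MultilinearMap 𝕜 (fun _ : Fin (k + 1) => A) A)
    (hM : IsMomentFamily P M) :
    ∀ (k : ℕ) (t : Fin (k + 1) → ℝ≥0) (a : Fin (k + 1) → A),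
      ‖M k t a‖ ≤ ∏ i, ‖a i‖ := by
  intro k
  induction k using Nat.strong_induction_on with
  | _ k ih =>
    intro t a
    obtain ⟨l, hl⟩ := Finite.exists_min t
    have ht : t = fun i => (t i - t l) + t l := funext fun i => (tsub_add_cancel_of_le (hl i)).symm
    rw [ht, ← hM.1 k (fun i => t i - t l) (t l) a]
    exact (hPcontr _ _).trans (hM.norm_le_of_time_eq_zero ih _ a l (tsub_self _))
end

section
/- Let B be a C*-algebra, A a closed *-subalgebra of B, and α = (α_t)_{t≥0} a semigroup of *-endomorphisms of B with α_0 = id, such that B is the closed linear span of the set of all finite products α_{t_1}(a_1) α_{t_2}(a_2) ⋯ α_{t_k}(a_k) with k ≥ 1, t_1,…,t_k ≥ 0 and a_1,…,a_k ∈ A. If E and E′ are two α-expectations onto A satisfying E(α_t(a)) = E′(α_t(a)) for all a ∈ A and all t ≥ 0, then E = E′. -/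
open scoped NNReal

/-- The ordered product `f 0 * f 1 * ⋯ * f k` of a nonempty finite tuple of
elements of a (possibly nonunital) multiplicative structure. -/
def finProd {B : Type*} [Mul B] : ∀ k : ℕ, (Fin (k + 1) → B) → B
  | 0, f => f 0
  | k + 1, f => f 0 * finProd k fun i => f i.succ

/-- The hereditary subalgebra of `B` generated by `A`: the closed linear span
of `{a * x * b : a, b ∈ A, x ∈ B}`. -/
def heredClosure {B : Type*} [NonUnitalNormedRing B] [NormedSpace ℂ B]
    [IsScalarTower ℂ B B] [SMulCommClass ℂ B B] [StarRing B] [StarModule ℂ B]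
    (A : NonUnitalStarSubalgebra ℂ B) : Set B :=
  closure (↑(Submodule.span ℂ {y : B | ∃ a ∈ A, ∃ b ∈ A, ∃ x : B, y = a * x * b}) : Set B)

/-- `E` is an `α`-expectation onto the closed `*`-subalgebra `A`: a bounded
linear idempotent map with range `A`, positive, an `A`-bimodule map,
equivariant (E1), and multiplicative on the hereditary subalgebra generated
by `A` (E2). -/
def IsAlphaExpectation {B : Type*} [NonUnitalNormedRing B] [StarRing B] [CStarRing B]
    [CompleteSpace B] [NormedSpace ℂ B] [IsScalarTower ℂ B B] [SMulCommClass ℂ B B]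
    [StarModule ℂ B] [PartialOrder B] [StarOrderedRing B]
    (A : NonUnitalStarSubalgebra ℂ B) (α : ℝ≥0 → B →⋆ₙₐ[ℂ] B) (E : B →L[ℂ] B) : Prop :=
  (∀ x : B, E (E x) = E x) ∧
  (Set.range (E : B → B) = (A : Set B)) ∧
  (∀ x : B, 0 ≤ x → 0 ≤ E x) ∧
  (∀ a ∈ A, ∀ x : B, E (a * x) = a * E x) ∧
  (∀ a ∈ A, ∀ x : B, E (x * a) = E x * a) ∧
  (∀ (t : ℝ≥0) (x : B), E (α t (E x)) = E (α t x)) ∧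
  (∀ x ∈ heredClosure A, ∀ y ∈ heredClosure A, E (x * y) = E x * E y)

/-- Every self-adjoint element of a C*-algebra is a product of two elements. -/
theorem exists_eq_mul_of_isSelfAdjoint {B : Type*} [NonUnitalCStarAlgebra B] {b : B}
    (hb : IsSelfAdjoint b) : ∃ c d : B, b = c * d := by
  refine ⟨cfcₙ (fun x : ℝ ↦ √x - √(-x)) b, cfcₙ (fun x : ℝ ↦ √x + √(-x)) b, ?_⟩
  rw [← cfcₙ_mul _ _ b]
  conv_lhs => rw [← cfcₙ_id' ℝ b]
  refine cfcₙ_congr fun x _ ↦ ?_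
  rcases le_total 0 x with hx | hx
  · simp [Real.sqrt_eq_zero_of_nonpos (neg_nonpos.2 hx), Real.mul_self_sqrt hx]
  · simp [Real.sqrt_eq_zero_of_nonpos hx, Real.mul_self_sqrt (neg_nonneg.2 hx)]

/-- An element annihilated by two-sided multiplication by its own adjoint vanishes. -/
theorem eq_zero_of_star_mul_mul_star {B : Type*} [NonUnitalNormedRing B] [StarRing B]
    [CStarRing B] {w : B} (h : star w * w * star w = 0) : w = 0 := by
  rw [← CStarRing.star_mul_self_eq_zero_iff, ← CStarRing.star_mul_self_eq_zero_iff]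
  rw [star_mul, star_star, ← mul_assoc, h, zero_mul]

section

variable {B : Type*} [NonUnitalNormedRing B] [StarRing B] [CStarRing B] [CompleteSpace B]
  [NormedSpace ℂ B] [IsScalarTower ℂ B B] [SMulCommClass ℂ B B] [StarModule ℂ B]
  {A : NonUnitalStarSubalgebra ℂ B} {α : ℝ≥0 → B →⋆ₙₐ[ℂ] B}

/-- A closed `*`-subalgebra of a C*-algebra is spanned by products of pairs of its elements. -/
theorem NonUnitalStarSubalgebra.mem_span_mul (hA : IsClosed (A : Set B)) {a : B} (ha : a ∈ A) :
    a ∈ Submodule.span ℂ {y : B | ∃ c ∈ A, ∃ d ∈ A, y = c * d} := by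
  let _ : NonUnitalCStarAlgebra B := {}
  have : IsClosed (A : Set B) := hA
  have key : ∀ b : A, IsSelfAdjoint b →
      (b : B) ∈ Submodule.span ℂ {y : B | ∃ c ∈ A, ∃ d ∈ A, y = c * d} := by
    intro b hb
    obtain ⟨c, d, rfl⟩ := exists_eq_mul_of_isSelfAdjoint hb
    exact Submodule.subset_span ⟨c, c.2, d, d.2, rfl⟩
  have h := congrArg (fun x : A ↦ (x : B)) (realPart_add_I_smul_imaginaryPart (⟨a, ha⟩ : A))
  have h' : a = _ := h.symm
  rw [h']
  exact Submodule.add_mem _ (key _ (realPart _).2)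
    (Submodule.smul_mem _ _ (key _ (imaginaryPart _).2))

/-- An `α`-expectation splits at every element of the range sitting inside a product. -/
theorem IsAlphaExpectation.map_mul_mul [PartialOrder B] [StarOrderedRing B]
    (hA : IsClosed (A : Set B)) {E : B →L[ℂ] B}
    (hE : IsAlphaExpectation A α E) {a : B} (ha : a ∈ A) (y z : B) :
    E (y * a * z) = E y * a * E z := by
  obtain ⟨-, hran, -, hl, hr, -, hmul⟩ := hE
  have hmem : ∀ x, E x ∈ A := fun x ↦ by
    rw [← SetLike.mem_coe, ← hran]
    exact Set.mem_range_self x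
  have hmulA : ∀ c ∈ A, ∀ d ∈ A, E (y * (c * d) * z) = E y * (c * d) * E z := by
    intro c hc d hd
    have hw : E (y * (c * d) * z) - E y * (c * d) * E z ∈ A :=
      sub_mem (hmem _) (mul_mem (mul_mem (hmem _) (mul_mem hc hd)) (hmem _))
    have hzero : ∀ p ∈ A, ∀ q ∈ A,
        p * (E (y * (c * d) * z) - E y * (c * d) * E z) * q = 0 := by
      intro p hp q hq
      have h := hmul (p * y * c) (subset_closure (Submodule.subset_span ⟨p, hp, c, hc, y, rfl⟩))
        (d * z * q) (subset_closure (Submodule.subset_span ⟨d, hd, q, hq, z, rfl⟩))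
      rw [hr c hc, hl p hp, hr q hq, hl d hd,
        show p * y * c * (d * z * q) = p * (y * (c * d) * z) * q by simp only [mul_assoc],
        hr q hq, hl p hp] at h
      rw [mul_sub, sub_mul, h, sub_eq_zero]
      simp only [mul_assoc]
    exact sub_eq_zero.1 (eq_zero_of_star_mul_mul_star
      (hzero _ (star_mem hw) _ (star_mem hw)))
  have hspan := NonUnitalStarSubalgebra.mem_span_mul hA ha
  clear ha
  induction hspan using Submodule.span_induction with
  | mem x hx =>
    obtain ⟨c, hc, d, hd, rfl⟩ := hx
    exact hmulA c hc d hd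
  | zero => simp
  | add u v _ _ hu hv => simp only [mul_add, add_mul, map_add, *]
  | smul r u _ hu => simp only [mul_smul_comm, smul_mul_assoc, map_smul, *]

end

section

variable {B : Type*} [NonUnitalNormedRing B] [StarRing B] [NormedSpace ℂ B]
  {A : NonUnitalStarSubalgebra ℂ B} {α : ℝ≥0 → B →⋆ₙₐ[ℂ] B}

variable (A α) in
/-- `IsWord A α n x` says that `x` is a product of `n + 1` elements `α t a` with `a ∈ A`. -/
inductive IsWord : ℕ → B → Prop
  | single (t : ℝ≥0) {a : B} (ha : a ∈ A) : IsWord 0 (α t a)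
  | cons (t : ℝ≥0) {a : B} (ha : a ∈ A) {n : ℕ} {x : B} (hx : IsWord n x) :
      IsWord (n + 1) (α t a * x)

theorem isWord_finProd (k : ℕ) (t : Fin (k + 1) → ℝ≥0) (a : Fin (k + 1) → A) :
    IsWord A α k (finProd k fun i ↦ α (t i) (a i : B)) := by
  induction k with
  | zero => exact .single _ (a 0).2
  | succ k ih => exact .cons _ (a 0).2 (ih (fun i ↦ t i.succ) (fun i ↦ a i.succ))

theorem IsWord.map (hαadd : ∀ (s t : ℝ≥0) (x : B), α (s + t) x = α s (α t x)) (s : ℝ≥0)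
    {n : ℕ} {x : B} (hx : IsWord A α n x) : IsWord A α n (α s x) := by
  induction hx with
  | single t ha => rw [← hαadd]; exact .single _ ha
  | cons t ha _ ih => rw [map_mul, ← hαadd]; exact .cons _ ha ih

/-- Pulling out the smallest time exhibits a word as the image under some `α s` of a product of
an element of `A` with at most one shorter word on either side. -/
theorem IsWord.exists_eq_map (hα0 : ∀ x : B, α 0 x = x)
    (hαadd : ∀ (s t : ℝ≥0) (x : B), α (s + t) x = α s (α t x))
    {n : ℕ} {x : B} (hx : IsWord A α n x) :
    ∃ s : ℝ≥0, ∃ a ∈ A, ∃ x' : B, IsWord A α n x' ∧ x = α s x' ∧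
      (x' = a ∨ (∃ m < n, ∃ z, IsWord A α m z ∧ x' = a * z) ∨
        (∃ m < n, ∃ y, IsWord A α m y ∧ x' = y * a) ∨
        ∃ m < n, ∃ y, IsWord A α m y ∧ ∃ l < n, ∃ z, IsWord A α l z ∧ x' = y * a * z) := by
  induction hx with
  | single t ha =>
    refine ⟨t, _, ha, _, ?_, rfl, .inl rfl⟩
    have h := IsWord.single (A := A) (α := α) 0 ha
    rwa [hα0] at h
  | @cons t b hb n x hx ih =>
    obtain ⟨s, a, ha, x', hx', rfl, h⟩ := ih
    rcases le_total t s with hts | hst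
    · obtain ⟨r, rfl⟩ := exists_add_of_le hts
      refine ⟨t, b, hb, b * α r x', ?_, by rw [map_mul, ← hαadd],
        .inr (.inl ⟨n, n.lt_succ_self, α r x', hx'.map hαadd r, rfl⟩)⟩
      simpa only [hα0] using IsWord.cons 0 hb (hx'.map hαadd r)
    · obtain ⟨r, rfl⟩ := exists_add_of_le hst
      refine ⟨s, a, ha, α r b * x', .cons r hb hx', by rw [hαadd, map_mul], ?_⟩
      rcases h with rfl | ⟨m, hm, z, hz, rfl⟩ | ⟨m, hm, y, hy, rfl⟩ |
        ⟨m, hm, y, hy, l, hl, z, hz, rfl⟩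
      · exact .inr (.inr (.inl ⟨0, n.succ_pos, _, .single r hb, rfl⟩))
      · exact .inr (.inr (.inr ⟨0, n.succ_pos, _, .single r hb, m, by lia, z, hz,
          (mul_assoc _ _ _).symm⟩))
      · exact .inr (.inr (.inl ⟨m + 1, by lia, _, .cons r hb hy, (mul_assoc _ _ _).symm⟩))
      · exact .inr (.inr (.inr ⟨m + 1, by lia, _, .cons r hb hy, l, by lia, z, hz,
          by simp only [mul_assoc]⟩))

end

/-- **Uniqueness of `α`-expectations.**  Let `B` be a C*-algebra, `A` a closed
`*`-subalgebra, and `α = (α_t)_{t ≥ 0}` a semigroup of `*`-endomorphisms of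
`B` with `α_0 = id`, such that `B` is the closed linear span of all finite
products `α_{t_1}(a_1) ⋯ α_{t_k}(a_k)` with entries from `A`.  If two
`α`-expectations `E`, `E'` onto `A` agree on all elements `α_t(a)`, `a ∈ A`,
then `E = E'`. -/
theorem alphaExpectation_unique
    {B : Type*} [NonUnitalNormedRing B] [StarRing B] [CStarRing B] [CompleteSpace B]
    [NormedSpace ℂ B] [IsScalarTower ℂ B B] [SMulCommClass ℂ B B]
    [StarModule ℂ B] [PartialOrder B] [StarOrderedRing B]
    (A : NonUnitalStarSubalgebra ℂ B) (hA : IsClosed (A : Set B))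
    (α : ℝ≥0 → B →⋆ₙₐ[ℂ] B) (hα0 : ∀ x : B, α 0 x = x)
    (hαadd : ∀ (s t : ℝ≥0) (x : B), α (s + t) x = α s (α t x))
    (hspan : closure (↑(Submodule.span ℂ
        {x : B | ∃ (k : ℕ) (t : Fin (k + 1) → ℝ≥0) (a : Fin (k + 1) → ↥A),
          x = finProd k fun i => α (t i) ((a i : B))}) : Set B) = Set.univ)
    (E E' : B →L[ℂ] B)
    (hE : IsAlphaExpectation A α E) (hE' : IsAlphaExpectation A α E')
    (hagree : ∀ (t : ℝ≥0) (a : ↥A), E (α t (a : B)) = E' (α t (a : B))) :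
    E = E' := by
  have hword : ∀ (n : ℕ) (x : B), IsWord A α n x → E x = E' x := by
    intro n
    induction n using Nat.strong_induction_on with
    | _ n ih =>
      intro x hx
      obtain ⟨s, a, ha, x', -, rfl, h⟩ := hx.exists_eq_map hα0 hαadd
      have hx' : E x' = E' x' := by
        rcases h with rfl | ⟨m, hm, z, hz, rfl⟩ | ⟨m, hm, y, hy, rfl⟩ |
          ⟨m, hm, y, hy, l, hl, z, hz, rfl⟩
        · simpa only [hα0] using hagree 0 ⟨x', ha⟩
        · rw [hE.2.2.2.1 a ha, hE'.2.2.2.1 a ha, ih m hm z hz]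
        · rw [hE.2.2.2.2.1 a ha, hE'.2.2.2.2.1 a ha, ih m hm y hy]
        · rw [hE.map_mul_mul hA ha, hE'.map_mul_mul hA ha, ih m hm y hy, ih l hl z hz]
      have hmem : E x' ∈ A := by
        rw [← SetLike.mem_coe, ← hE.2.1]
        exact Set.mem_range_self x'
      rw [← hE.2.2.2.2.2.1, ← hE'.2.2.2.2.2.1, ← hx']
      exact hagree s ⟨E x', hmem⟩
  refine ContinuousLinearMap.ext_on (dense_iff_closure_eq.2 hspan) ?_
  rintro _ ⟨k, t, a, rfl⟩
  exact hword k _ (isWord_finProd k t a)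
end

section
/- Let B be a C*-algebra, A a closed *-subalgebra of B, and let E : B → B be a bounded linear idempotent map with range A, positive, satisfying E(ax) = aE(x) and E(xa) = E(x)a for all a ∈ A, x ∈ B, and multiplicative on the hereditary subalgebra generated by A, i.e. E(xy) = E(x)E(y) for all x, y in the closed linear span of {axb : a, b ∈ A, x ∈ B}. Then E(x a y) = E(x) · a · E(y) for all x, y ∈ B and all a ∈ A. -/
open Filter in
/-- In a closed `*`-subalgebra of a C*-algebra, each element `a` is a limit of
products `a * u` with `u` in the subalgebra. -/
theorem mem_closure_mul_mem {B : Type*} [NonUnitalCStarAlgebra B]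
    (A : NonUnitalStarSubalgebra ℂ B) (hA : IsClosed (A : Set B)) {a : B} (ha : a ∈ A) :
    a ∈ closure {y : B | ∃ u ∈ A, y = a * u} := by
  have : IsClosed (A : Set B) := hA
  let : PartialOrder A := CStarAlgebra.spectralOrder A
  have : StarOrderedRing A := CStarAlgebra.spectralOrderedRing A
  have h := (CStarAlgebra.increasingApproximateUnit A).tendsto_mul_left ⟨a, ha⟩
  have h' := (continuous_subtype_val.tendsto _).comp h
  exact mem_closure_of_tendsto h' (Eventually.of_forall fun u => ⟨u, u.2, rfl⟩)

/-- **The bimodule-multiplicativity property of conditional expectations.**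
Let `B` be a C*-algebra, `A` a closed `*`-subalgebra, and `E : B → B` a
bounded linear idempotent map with range `A` which is positive, satisfies
`E(ax) = aE(x)` and `E(xa) = E(x)a` for `a ∈ A`, and is multiplicative on the
hereditary subalgebra generated by `A`.  Then `E(x a y) = E(x)·a·E(y)` for all
`x, y ∈ B` and `a ∈ A`. -/
theorem condExp_middle_multiplicative
    {B : Type*} [NonUnitalNormedRing B] [StarRing B] [CStarRing B] [CompleteSpace B]
    [NormedSpace ℂ B] [IsScalarTower ℂ B B] [SMulCommClass ℂ B B]
    [StarModule ℂ B] [PartialOrder B] [StarOrderedRing B]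
    (A : NonUnitalStarSubalgebra ℂ B) (hA : IsClosed (A : Set B))
    (E : B →L[ℂ] B)
    (hidem : ∀ x : B, E (E x) = E x)
    (hrange : Set.range (E : B → B) = (A : Set B))
    (hpos : ∀ x : B, 0 ≤ x → 0 ≤ E x)
    (hleft : ∀ a ∈ A, ∀ x : B, E (a * x) = a * E x)
    (hright : ∀ a ∈ A, ∀ x : B, E (x * a) = E x * a)
    (hmult : ∀ x ∈ heredClosure A, ∀ y ∈ heredClosure A, E (x * y) = E x * E y) :
    ∀ (x y : B), ∀ a ∈ A, E (x * a * y) = E x * a * E y := by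
  intro x y a ha
  have hE : ∀ z, E z ∈ A := fun z => by
    rw [← SetLike.mem_coe, ← hrange]; exact ⟨z, rfl⟩
  have hsub : ∀ b ∈ A, ∀ c ∈ A, ∀ z, b * z * c ∈ heredClosure A := fun b hb c hc z =>
    subset_closure (Submodule.subset_span ⟨b, hb, c, hc, z, rfl⟩)
  have hsandwich : ∀ e ∈ A, ∀ f ∈ A, E (e * x * a * (y * f)) = e * E x * a * (E y * f) := by
    intro e he f hf
    have hclosed : IsClosed {b : B | E (e * x * b * (y * f)) = e * E x * b * (E y * f)} :=
      isClosed_eq (by fun_prop) (by fun_prop)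
    let : NonUnitalCStarAlgebra B := {}
    refine closure_minimal ?_ hclosed (mem_closure_mul_mem A hA ha)
    rintro _ ⟨u, hu, rfl⟩
    have h := hmult _ (hsub e he a ha x) _ (hsub u hu f hf y)
    rw [hright a ha, hleft e he, hright f hf, hleft u hu] at h
    simpa only [Set.mem_ofPred_eq, mul_assoc] using h
  rw [← sub_eq_zero]
  set d := E (x * a * y) - E x * a * E y with hd
  have hdA : d ∈ A := sub_mem (hE _) (mul_mem (mul_mem (hE _) ha) (hE _))
  have hcorner : star d * d * star d = 0 := by
    have h := hsandwich _ (star_mem hdA) _ (star_mem hdA)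
    have h' : star d * x * a * (y * star d) = star d * (x * a * y) * star d := by
      simp only [mul_assoc]
    rw [h', hright _ (star_mem hdA), hleft _ (star_mem hdA)] at h
    nth_rewrite 2 [hd]
    rw [mul_sub, sub_mul, h, sub_eq_zero]
    simp only [mul_assoc]
  have hsq : star (star d * d) * (star d * d) = 0 := by
    rw [star_mul, star_star, ← mul_assoc, hcorner, zero_mul]
  exact CStarRing.star_mul_self_eq_zero_iff d |>.1
    (CStarRing.star_mul_self_eq_zero_iff (star d * d) |>.1 hsq)
end

section
/- Let M be a unital C*-algebra, let α = (α_t)_{t≥0} be a semigroup of (not necessarily unital) *-homomorphisms of M into itself with α_0 = id and α_{s+t} = α_s ∘ α_t, and let p ∈ M be a projection (p = p* = p²) that is coinvariant for α, i.e. α_t(1 − p) ≤ 1 − p for every t ≥ 0. Define P_t on the corner pMp by P_t(a) = p α_t(a) p. Then: (i) P_t(p x p) = p α_t(x) p for every x ∈ M and t ≥ 0; (ii) P is a semigroup on pMp, i.e. p α_{s+t}(a) p = p α_s(p α_t(a) p) p for all a ∈ pMp and s, t ≥ 0; (iii) each P_t is a positive contraction on pMp (0 ≤ a implies 0 ≤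 P_t(a), and ‖P_t(a)‖ ≤ ‖a‖); and (iv) if moreover α_t(1) = 1 for all t ≥ 0, then P_t(p) = p for all t ≥ 0. -/
open scoped NNReal

/-- In a C⋆-ring, if a star projection `e` is dominated by `1 - p` for a star projection `p`,
then `e * p = 0`. -/
theorem IsStarProjection.mul_eq_zero_of_le_one_sub
    {M : Type*} [NormedRing M] [StarRing M] [CStarRing M] [PartialOrder M] [StarOrderedRing M]
    {e p : M} (he : IsStarProjection e) (hp : IsStarProjection p) (h : e ≤ 1 - p) :
    e * p = 0 := by
  have hstar : star (e * p) * (e * p) = p * e * p := by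
    rw [star_mul, he.isSelfAdjoint.star_eq, hp.isSelfAdjoint.star_eq, mul_assoc,
      ← mul_assoc e e p, he.isIdempotentElem.eq, mul_assoc]
  have hle : p * e * p ≤ 0 := by
    have hconj := star_left_conjugate_le_conjugate h p
    rw [hp.isSelfAdjoint.star_eq] at hconj
    simpa [mul_sub, hp.isIdempotentElem.eq] using hconj
  rw [← CStarRing.star_mul_self_eq_zero_iff]
  exact le_antisymm (hstar ▸ hle) (star_mul_self_nonneg _)

/-- **Compression of an `E`-semigroup to a coinvariant corner.**
Let `M` be a unital C*-algebra, `α = (α_t)_{t ≥ 0}` a semigroup of (not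
necessarily unital) `*`-homomorphisms of `M` with `α_0 = id`, and let `p` be a
projection that is coinvariant for `α`, i.e. `α_t(1 - p) ≤ 1 - p`.  With
`P_t(a) = p α_t(a) p` on the corner `pMp = {a : p a p = a}` one has:
(i) `P_t(p x p) = p α_t(x) p`; (ii) `P` is a semigroup on the corner;
(iii) each `P_t` is a positive contraction on the corner; and (iv) if `α` is
unital then `P_t(p) = p`. -/
theorem compression_of_coinvariant_projection
    {M : Type*} [NormedRing M] [StarRing M] [CStarRing M] [CompleteSpace M]
    [NormedAlgebra ℂ M] [StarModule ℂ M] [PartialOrder M] [StarOrderedRing M]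
    (α : ℝ≥0 → M →⋆ₙₐ[ℂ] M) (hα0 : ∀ x : M, α 0 x = x)
    (hαadd : ∀ (s t : ℝ≥0) (x : M), α (s + t) x = α s (α t x))
    (p : M) (hpsa : star p = p) (hpidem : p * p = p)
    (hcoinv : ∀ t : ℝ≥0, α t (1 - p) ≤ 1 - p) :
    (∀ (x : M) (t : ℝ≥0), p * α t (p * x * p) * p = p * α t x * p) ∧
    (∀ a : M, p * a * p = a → ∀ s t : ℝ≥0,
        p * α (s + t) a * p = p * α s (p * α t a * p) * p) ∧
    (∀ (a : M) (t : ℝ≥0), p * a * p = a →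
        (0 ≤ a → 0 ≤ p * α t a * p) ∧ ‖p * α t a * p‖ ≤ ‖a‖) ∧
    ((∀ t : ℝ≥0, α t 1 = 1) → ∀ t : ℝ≥0, p * α t p * p = p) := by
  let _ : CStarAlgebra M := {}
  have hp : IsStarProjection p := ⟨hpidem, hpsa⟩
  have hmap : ∀ t, IsStarProjection (α t (1 - p)) := fun t => hp.one_sub.map (α t)
  have hright : ∀ t, α t (1 - p) * p = 0 := fun t =>
    (hmap t).mul_eq_zero_of_le_one_sub hp (hcoinv t)
  have hleft : ∀ t, p * α t (1 - p) = 0 := fun t => by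
    rw [← star_eq_zero, star_mul, (hmap t).isSelfAdjoint.star_eq, hpsa, hright]
  have hcomp : ∀ (x : M) (t : ℝ≥0), p * α t (p * x * p) * p = p * α t x * p := fun x t => by
    have hx : x = p * x * p + (1 - p) * x + p * x * (1 - p) := by noncomm_ring
    conv_rhs => rw [hx]
    rw [map_add, map_add, map_mul (α t) (1 - p) x, map_mul (α t) (p * x) (1 - p), mul_add,
      mul_add, add_mul, add_mul, ← mul_assoc p (α t (1 - p)), hleft, mul_assoc p (_ * _) p,
      mul_assoc _ (α t (1 - p)) p, hright]
    simp
  refine ⟨hcomp, fun a _ s t => ?_, fun a t _ => ⟨fun ha => ?_, ?_⟩, fun h1 t => ?_⟩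
  · rw [hcomp, hαadd]
  · simpa [hpsa] using star_left_conjugate_nonneg (map_nonneg (α t) ha) p
  · have hp1 := IsStarProjection.norm_le p hp
    calc ‖p * α t a * p‖ ≤ ‖p‖ * ‖α t a‖ * ‖p‖ := norm_mul₃_le
      _ ≤ 1 * ‖a‖ * 1 := by
        gcongr
        exact NonUnitalStarAlgHom.norm_apply_le (α t) a
      _ = ‖a‖ := by simp
  · simpa [h1, hpidem] using hcomp 1 t
end

section
/- Let H be a complex Hilbert space, let α : B(H) → B(H) be a *-homomorphism of the algebra B(H) of bounded operators on H, and let S, T ∈ B(H) satisfy α(A)S = SA and α(A)T = TA for every A ∈ B(H). Then T*S is a scalar multiple of the identity: there exists c ∈ ℂ with T* ∘ S = c · 1. -/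
/-- **Intertwiners pair to scalars.**  Let `H` be a complex Hilbert space,
`α` a `*`-homomorphism of `B(H)` into itself, and let `S, T ∈ B(H)` satisfy
`α(A)S = SA` and `α(A)T = TA` for every `A ∈ B(H)`.  Then `T*S` is a scalar
multiple of the identity operator. -/
theorem intertwiner_inner_product
    {H : Type*} [NormedAddCommGroup H] [InnerProductSpace ℂ H] [CompleteSpace H]
    (α : (H →L[ℂ] H) →⋆ₙₐ[ℂ] (H →L[ℂ] H))
    (S T : H →L[ℂ] H)
    (hS : ∀ A : H →L[ℂ] H, α A * S = S * A)
    (hT : ∀ A : H →L[ℂ] H, α A * T = T * A) :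
    ∃ c : ℂ, star T * S = c • (1 : H →L[ℂ] H) := by
  have hT' : ∀ A : H →L[ℂ] H, star T * α A = A * star T := fun A => by
    simpa [map_star] using congrArg star (hT (star A))
  have hcenter : star T * S ∈ Subalgebra.center ℂ (H →L[ℂ] H) :=
    Subalgebra.mem_center_iff.mpr fun A => by
      rw [← mul_assoc, ← hT', mul_assoc, hS, mul_assoc]
  obtain ⟨c, hc⟩ := Algebra.mem_bot.mp (Algebra.IsCentral.out hcenter)
  exact ⟨c, by rw [← hc, Algebra.algebraMap_eq_smul_one]⟩
end

section
/- Let H be a complex Hilbert space, α = (α_t)_{t≥0} a semigroup of *-endomorphisms of B(H) (α_{s+t} = α_s ∘ α_t), and U = (U_t)_{t≥0} a family of unitary operators on H satisfying the cocycle equation U_{s+t} = U_s α_s(U_t) for all s, t ≥ 0; let β_t(A) = U_t α_t(A) U_t* be the corresponding cocycle perturbation. Then: (i) for every t ≥ 0 and every T ∈ E_α(t), the operator U_t T belongs to E_β(t), i.e. β_t(A)(U_t T) = (U_t T)A for all A ∈ B(H); and (ii) for all s, t ≥ 0, S ∈ E_α(s) and T ∈ E_α(t), one has U_{s+t}(ST)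 = (U_s S)(U_t T). -/
open scoped NNReal

/-- **Cocycle perturbations and intertwiner spaces.**  Let `H` be a complex
Hilbert space, `α = (α_t)_{t ≥ 0}` a semigroup of `*`-endomorphisms of
`B(H)`, and `U = (U_t)_{t ≥ 0}` a cocycle of unitaries for `α`
(`U_{s+t} = U_s α_s(U_t)`), and let `β_t(A) = U_t α_t(A) U_t*`.  Then:
(i) for every `T ∈ E_α(t)`, the operator `U_t T` lies in `E_β(t)`; and
(ii) `U_{s+t}(ST) = (U_s S)(U_t T)` for `S ∈ E_α(s)`, `T ∈ E_α(t)`. -/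
theorem cocycle_perturbation_intertwiners
    {H : Type*} [NormedAddCommGroup H] [InnerProductSpace ℂ H] [CompleteSpace H]
    (α : ℝ≥0 → (H →L[ℂ] H) →⋆ₙₐ[ℂ] (H →L[ℂ] H))
    (hαadd : ∀ (s t : ℝ≥0) (A : H →L[ℂ] H), α (s + t) A = α s (α t A))
    (U : ℝ≥0 → (H →L[ℂ] H)) (hU : ∀ t : ℝ≥0, U t ∈ unitary (H →L[ℂ] H))
    (hcoc : ∀ s t : ℝ≥0, U (s + t) = U s * α s (U t)) :
    (∀ (t : ℝ≥0) (T : H →L[ℂ] H), (∀ A : H →L[ℂ] H, α t A * T = T * A) →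
      ∀ A : H →L[ℂ] H, (U t * α t A * star (U t)) * (U t * T) = (U t * T) * A) ∧
    (∀ (s t : ℝ≥0) (S T : H →L[ℂ] H),
      (∀ A : H →L[ℂ] H, α s A * S = S * A) →
      (∀ A : H →L[ℂ] H, α t A * T = T * A) →
      U (s + t) * (S * T) = (U s * S) * (U t * T)) := by
  refine ⟨fun t T hT A => ?_, fun s t S T hS _ => ?_⟩
  · calc U t * α t A * star (U t) * (U t * T)
        = U t * α t A * (star (U t) * U t) * T := by simp only [mul_assoc]
      _ = U t * (α t A * T) := by rw [Unitary.star_mul_self_of_mem (hU t), mul_one, mul_assoc]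
      _ = U t * T * A := by rw [hT, mul_assoc]
  · calc U (s + t) * (S * T) = U s * (α s (U t) * S) * T := by rw [hcoc]; simp only [mul_assoc]
      _ = U s * S * (U t * T) := by rw [hS]; simp only [mul_assoc]
end

section
/- Let H be a complex Hilbert space, let M be a von Neumann algebra on H (so M equals its double commutant M′′) with commutant M′, and let U = (U_t)_{t∈ℝ} be a one-parameter group of unitary operators on H (U_0 = 1, U_{s+t} = U_s U_t). For t > 0 define E_α(t) = {T ∈ M : (U_t A U_t*)T = TA for all A ∈ M} and E_β(t) = {S ∈ M′ : (U_t* B U_t)S = SB for all B ∈ M′}. Then for every s, t > 0: (i) E_β(t) = {U_t* T : T ∈ E_α(t)}; (ii) (U_t* T_2)* (U_t* T_1) = T_2* T_1 for all T_1, T_2 ∈ E_α(t); and (iii) for S ∈ E_α(s) and T ∈ E_α(t), U_{s+t}* (ST) = (U_t* T)(U_s* S), i.e. the maps θ_t(T) = U_t* T assemble to an inner-product-preserving anti-multiplicative bijection from the spaces E_α onto the spaces E_β. -/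
/-- For a von Neumann algebra `M` on `H`, a one-parameter unitary group `U`
and `t : ℝ`, the intertwiner space
`E_α(t) = {T ∈ M : (U_t A U_t*) T = T A for all A ∈ M}`. -/
def Ealpha {H : Type*} [NormedAddCommGroup H] [InnerProductSpace ℂ H] [CompleteSpace H]
    (M : VonNeumannAlgebra H) (U : ℝ → (H →L[ℂ] H)) (t : ℝ) : Set (H →L[ℂ] H) :=
  {T | T ∈ M ∧ ∀ A ∈ M, (U t * A * star (U t)) * T = T * A}

/-- For a von Neumann algebra `M` on `H`, a one-parameter unitary group `U`
and `t : ℝ`, the intertwiner space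
`E_β(t) = {S ∈ M′ : (U_t* B U_t) S = S B for all B ∈ M′}`. -/
def Ebeta {H : Type*} [NormedAddCommGroup H] [InnerProductSpace ℂ H] [CompleteSpace H]
    (M : VonNeumannAlgebra H) (U : ℝ → (H →L[ℂ] H)) (t : ℝ) : Set (H →L[ℂ] H) :=
  {S | S ∈ M.commutant ∧ ∀ B ∈ M.commutant, (star (U t) * B * U t) * S = S * B}

/-- For a unitary `u`, the intertwining relation `(u a u*) x = x a` says that `u* x`
commutes with `a`. -/
theorem conj_mul_eq_mul_iff_of_mem_unitary {R : Type*} [Monoid R] [StarMul R] {u : R}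
    (hu : u ∈ unitary R) (a x : R) :
    (u * a * star u) * x = x * a ↔ a * (star u * x) = (star u * x) * a := by
  constructor <;> intro h
  · calc a * (star u * x) = star u * ((u * a * star u) * x) := by
          simp only [← mul_assoc, Unitary.star_mul_self_of_mem hu, one_mul]
      _ = (star u * x) * a := by rw [h, mul_assoc]
  · calc (u * a * star u) * x = u * (a * (star u * x)) := by simp only [mul_assoc]
      _ = x * a := by
          rw [h]
          simp only [← mul_assoc, Unitary.mul_star_self_of_mem hu, one_mul]

section Intertwiner

variable {H : Type*} [NormedAddCommGroup H] [InnerProductSpace ℂ H] [CompleteSpace H]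
  {M : VonNeumannAlgebra H} {U : ℝ → (H →L[ℂ] H)} {t : ℝ}

/-- An operator `T` intertwines the identity of `M` and the conjugation by `U_t` if and only if
`U_t* T` lies in the commutant of `M`. -/
theorem star_mul_mem_commutant_iff (hU : U t ∈ unitary (H →L[ℂ] H)) (T : H →L[ℂ] H) :
    star (U t) * T ∈ M.commutant ↔ ∀ A ∈ M, (U t * A * star (U t)) * T = T * A := by
  simp only [VonNeumannAlgebra.mem_commutant_iff, conj_mul_eq_mul_iff_of_mem_unitary hU]

/-- An operator `S` intertwines the identity of `M′` and the conjugation by `U_t*` if and only if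
`U_t S` lies in `M`. -/
theorem mul_mem_iff_forall_commutant (hU : U t ∈ unitary (H →L[ℂ] H)) (S : H →L[ℂ] H) :
    U t * S ∈ M ↔ ∀ B ∈ M.commutant, (star (U t) * B * U t) * S = S * B := by
  have h := fun B => conj_mul_eq_mul_iff_of_mem_unitary (Unitary.star_mem hU) B S
  simp only [star_star] at h
  rw [← M.commutant_commutant, VonNeumannAlgebra.mem_commutant_iff, M.commutant_commutant]
  simp only [h]

theorem mem_Ealpha_iff_star_mul_mem_Ebeta (hU : U t ∈ unitary (H →L[ℂ] H)) (T : H →L[ℂ] H) :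
    T ∈ Ealpha M U t ↔ star (U t) * T ∈ Ebeta M U t := by
  have hT : U t * (star (U t) * T) = T := by
    rw [← mul_assoc, Unitary.mul_star_self_of_mem hU, one_mul]
  simp only [Ealpha, Ebeta, Set.mem_ofPred_eq, ← star_mul_mem_commutant_iff hU,
    ← mul_mem_iff_forall_commutant hU, hT, and_comm]

theorem Ebeta_eq_image_Ealpha (hU : U t ∈ unitary (H →L[ℂ] H)) :
    Ebeta M U t = (fun T => star (U t) * T) '' Ealpha M U t := by
  ext S
  constructor
  · intro hS
    have h : star (U t) * (U t * S) = S := by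
      rw [← mul_assoc, Unitary.star_mul_self_of_mem hU, one_mul]
    exact ⟨U t * S, (mem_Ealpha_iff_star_mul_mem_Ebeta hU _).2 (h.symm ▸ hS), h⟩
  · rintro ⟨T, hT, rfl⟩
    exact (mem_Ealpha_iff_star_mul_mem_Ebeta hU T).1 hT

end Intertwiner

/-- **The anti-isomorphism between past and future intertwiner spaces.**
Let `M` be a von Neumann algebra on a complex Hilbert space `H` and
`U = (U_t)_{t ∈ ℝ}` a one-parameter group of unitaries.  For `s, t > 0`:
(i) `E_β(t) = U_t* E_α(t)`; (ii) the maps `θ_t(T) = U_t* T` preserve the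
pairing: `(U_t* T₂)* (U_t* T₁) = T₂* T₁`; and (iii) they are
anti-multiplicative: `U_{s+t}*(ST) = (U_t* T)(U_s* S)` for `S ∈ E_α(s)`,
`T ∈ E_α(t)`. -/
theorem vonNeumann_intertwiner_antiIsomorphism
    {H : Type*} [NormedAddCommGroup H] [InnerProductSpace ℂ H] [CompleteSpace H]
    (M : VonNeumannAlgebra H)
    (U : ℝ → (H →L[ℂ] H)) (hU0 : U 0 = 1)
    (hUadd : ∀ s t : ℝ, U (s + t) = U s * U t)
    (hUuni : ∀ t : ℝ, U t ∈ unitary (H →L[ℂ] H)) :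
    ∀ s t : ℝ, 0 < s → 0 < t →
      (Ebeta M U t = (fun T => star (U t) * T) '' Ealpha M U t) ∧
      (∀ T₁ ∈ Ealpha M U t, ∀ T₂ ∈ Ealpha M U t,
        star (star (U t) * T₂) * (star (U t) * T₁) = star T₂ * T₁) ∧
      (∀ S ∈ Ealpha M U s, ∀ T ∈ Ealpha M U t,
        star (U (s + t)) * (S * T) = (star (U t) * T) * (star (U s) * S)) := by
  intro s t _ _
  refine ⟨Ebeta_eq_image_Ealpha (hUuni t), fun T₁ _ T₂ _ => ?_, fun S hS T hT => ?_⟩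
  · calc star (star (U t) * T₂) * (star (U t) * T₁)
        = star T₂ * ((U t * star (U t)) * T₁) := by simp only [star_mul, star_star, mul_assoc]
      _ = star T₂ * T₁ := by rw [Unitary.mul_star_self_of_mem (hUuni t), one_mul]
  · have hcomm : T * (star (U s) * S) = (star (U s) * S) * T :=
      VonNeumannAlgebra.mem_commutant_iff.1
        ((mem_Ealpha_iff_star_mul_mem_Ebeta (hUuni s) S).1 hS).1 T hT.1
    rw [hUadd, star_mul, mul_assoc (star (U t)) T, hcomm]
    simp only [mul_assoc]
end

section
/- Let μ and ν be finite positive measures on a measurable space (X, 𝒜) and let √(μν) denote their geometric mean measure. Then for all bounded measurable functions f, g : X → ℂ, one has |∫_X f·conj(g) d√(μν)|² ≤ (∫_X |f|² dμ) · (∫_X |g|² dν). -/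
open MeasureTheory

/-- The geometric mean `√(μν)` of two measures: the measure with density
`√(u·v)` with respect to `μ + ν`, where `u = dμ/d(μ+ν)` and `v = dν/d(μ+ν)`
are Radon–Nikodym derivatives. -/
noncomputable def geomMean {X : Type*} [MeasurableSpace X] (μ ν : Measure X) : Measure X :=
  (μ + ν).withDensity fun x => (μ.rnDeriv (μ + ν) x * ν.rnDeriv (μ + ν) x) ^ (1 / 2 : ℝ)

/-- Cauchy–Schwarz inequality for the geometric mean of measures, for Lebesgue integrals. -/
theorem lintegral_geomMean_rpow_mul_rpow_le
    {X : Type*} [MeasurableSpace X] (μ ν : Measure X) [SigmaFinite μ] [SigmaFinite ν]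
    {F G : X → ENNReal} (hF : Measurable F) (hG : Measurable G) :
    ∫⁻ x, F x ^ (1 / 2 : ℝ) * G x ^ (1 / 2 : ℝ) ∂(geomMean μ ν) ≤
      (∫⁻ x, F x ∂μ) ^ (1 / 2 : ℝ) * (∫⁻ x, G x ∂ν) ^ (1 / 2 : ℝ) := by
  have hu := Measure.measurable_rnDeriv μ (μ + ν)
  have hv := Measure.measurable_rnDeriv ν (μ + ν)
  have hμ : μ ≪ μ + ν := Measure.le_add_right le_rfl |>.absolutelyContinuous
  have hν : ν ≪ μ + ν := Measure.le_add_left le_rfl |>.absolutelyContinuous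
  rw [geomMean, lintegral_withDensity_eq_lintegral_mul _ (by fun_prop) (by fun_prop),
    ← lintegral_rnDeriv_mul hμ hF.aemeasurable, ← lintegral_rnDeriv_mul hν hG.aemeasurable]
  refine le_trans (lintegral_mono fun x => ?_) (ENNReal.lintegral_mul_norm_pow_le
    (hu.mul hF).aemeasurable (hv.mul hG).aemeasurable (by norm_num) (by norm_num) (by norm_num))
  simp only [Pi.mul_apply]
  have h : (0 : ℝ) ≤ 1 / 2 := by norm_num
  simp only [ENNReal.mul_rpow_of_nonneg _ _ h]
  exact (mul_mul_mul_comm _ _ _ _).le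

/-- The Lebesgue integral of the squared norm of a bounded function against a finite measure. -/
theorem lintegral_enorm_sq_eq_ofReal_of_bounded
    {X E : Type*} [MeasurableSpace X] [NormedAddCommGroup E] {μ : Measure X} [IsFiniteMeasure μ]
    {f : X → E} (hf : AEStronglyMeasurable f μ) (hfb : ∃ C : ℝ, ∀ x, ‖f x‖ ≤ C) :
    ∫⁻ x, ‖f x‖ₑ ^ 2 ∂μ = ENNReal.ofReal (∫ x, ‖f x‖ ^ 2 ∂μ) := by
  obtain ⟨C, hC⟩ := hfb
  have hint : Integrable (fun x => ‖f x‖ ^ 2) μ :=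
    (MemLp.of_bound hf C (.of_forall hC)).integrable_norm_pow two_ne_zero
  rw [ofReal_integral_eq_lintegral_ofReal hint (.of_forall fun x => by positivity)]
  simp [ENNReal.ofReal_pow]

/-- **The Cauchy–Schwarz property of the geometric mean of measures.**
For finite positive measures `μ, ν` and bounded measurable `f, g : X → ℂ`,
`|∫ f·conj(g) d√(μν)|² ≤ (∫ |f|² dμ)·(∫ |g|² dν)`. -/
theorem geomMean_cauchy_schwarz
    {X : Type*} [MeasurableSpace X] (μ ν : Measure X)
    [IsFiniteMeasure μ] [IsFiniteMeasure ν]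
    (f g : X → ℂ) (hf : Measurable f) (hg : Measurable g)
    (hfb : ∃ C : ℝ, ∀ x, ‖f x‖ ≤ C) (hgb : ∃ C : ℝ, ∀ x, ‖g x‖ ≤ C) :
    ‖∫ x, f x * (starRingEnd ℂ) (g x) ∂(geomMean μ ν)‖ ^ 2 ≤
      (∫ x, ‖f x‖ ^ 2 ∂μ) * (∫ x, ‖g x‖ ^ 2 ∂ν) := by
  have hA : 0 ≤ ∫ x, ‖f x‖ ^ 2 ∂μ := integral_nonneg fun x => by positivity
  have hsqrt (a : ENNReal) : (a ^ 2) ^ (1 / 2 : ℝ) = a := by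
    rw [← ENNReal.rpow_natCast_mul]; norm_num
  have hsq (a : ENNReal) : (a ^ (1 / 2 : ℝ)) ^ 2 = a := by
    rw [← ENNReal.rpow_mul_natCast]; norm_num
  have key : ‖∫ x, f x * (starRingEnd ℂ) (g x) ∂(geomMean μ ν)‖ₑ ≤
      (∫⁻ x, ‖f x‖ₑ ^ 2 ∂μ) ^ (1 / 2 : ℝ) * (∫⁻ x, ‖g x‖ₑ ^ 2 ∂ν) ^ (1 / 2 : ℝ) := by
    refine (enorm_integral_le_lintegral_enorm _).trans (le_trans (lintegral_mono fun x => ?_)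
      (lintegral_geomMean_rpow_mul_rpow_le μ ν (by fun_prop) (by fun_prop)))
    rw [hsqrt, hsqrt, enorm_mul, RCLike.enorm_conj]
  rw [← ENNReal.ofReal_le_ofReal_iff (mul_nonneg hA (integral_nonneg fun x => by positivity)),
    ENNReal.ofReal_mul hA, ENNReal.ofReal_pow (norm_nonneg _), ofReal_norm,
    ← lintegral_enorm_sq_eq_ofReal_of_bounded hf.aestronglyMeasurable hfb,
    ← lintegral_enorm_sq_eq_ofReal_of_bounded hg.aestronglyMeasurable hgb]
  simpa only [mul_pow, hsq] using pow_le_pow_left₀ zero_le key 2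
end

section
/- Let μ and ν be finite positive measures on a measurable space (X, 𝒜). If σ is a positive measure on (X, 𝒜) such that |∫_X f·conj(g) dσ|² ≤ (∫_X |f|² dμ)·(∫_X |g|² dν) for all bounded measurable functions f, g : X → ℂ, then σ ≤ √(μν); thus the geometric mean √(μν) is the largest positive measure with this property. -/
open MeasureTheory

open scoped ENNReal NNReal

/-- If the quadratic inequality `2 s q ≤ u q² + v` holds for all rational `q ≥ 0`, then
`s ≤ √(u v)`. -/
lemma le_sqrt_mul_of_forall_nnrat {s u v : ℝ≥0∞} (hs : s ≠ ∞) (hu : u ≠ ∞) (hv : v ≠ ∞)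
    (h : ∀ q : ℚ≥0, 2 * ((q : ℝ≥0) : ℝ≥0∞) * s ≤ ((q : ℝ≥0) : ℝ≥0∞) ^ 2 * u + v) :
    s ≤ (u * v) ^ (1 / 2 : ℝ) := by
  lift s to ℝ≥0 using hs
  lift u to ℝ≥0 using hu
  lift v to ℝ≥0 using hv
  have hrat : ∀ q : ℚ, 0 ≤ (u : ℝ) * ((q : ℝ) * q) + (-2 * s) * q + v := by
    intro q
    rcases le_total 0 q with hq | hq
    · lift q to ℚ≥0 using hq
      have hq' : 2 * (q : ℝ≥0) * s ≤ (q : ℝ≥0) ^ 2 * u + v := by exact_mod_cast h q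
      have hq'' : 2 * (q : ℝ) * s ≤ (q : ℝ) ^ 2 * u + v := by exact_mod_cast hq'
      push_cast
      linarith
    · have hq' : (q : ℝ) ≤ 0 := by exact_mod_cast hq
      nlinarith [mul_nonneg s.2 (neg_nonneg.2 hq'), mul_nonneg u.2 (mul_self_nonneg (q : ℝ)), v.2,
        s.coe_nonneg, u.coe_nonneg, v.coe_nonneg]
  have hreal : ∀ x : ℝ, 0 ≤ (u : ℝ) * (x * x) + (-2 * s) * x + v := fun x ↦
    Rat.denseRange_cast.induction_on x
      (isClosed_le continuous_const (by fun_prop)) hrat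
  have hdisc := discrim_le_zero hreal
  have hsq : (s : ℝ) ^ 2 ≤ u * v := by
    unfold discrim at hdisc
    linarith
  have hsq' : (s : ℝ≥0∞) ^ (2 : ℝ) ≤ u * v := by
    rw [ENNReal.rpow_two]
    exact_mod_cast hsq
  rw [one_div]
  exact (ENNReal.le_rpow_inv_iff two_pos).2 hsq'

/-- A measure `σ` with `σ(S)² ≤ μ(S) ν(S)` for all measurable `S` lies below the geometric mean. -/
lemma le_geomMean_of_sq_le_mul {X : Type*} [MeasurableSpace X] {μ ν σ : Measure X}
    [IsFiniteMeasure μ] [IsFiniteMeasure ν] [IsFiniteMeasure σ]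
    (h : ∀ S, MeasurableSet S → σ.real S ^ 2 ≤ μ.real S * ν.real S) :
    σ ≤ geomMean μ ν := by
  have hμ : μ ≪ μ + ν := (Measure.le_add_right le_rfl).absolutelyContinuous
  have hν : ν ≪ μ + ν := (Measure.le_add_left le_rfl).absolutelyContinuous
  have hσμ : σ ≪ μ := by
    refine Measure.AbsolutelyContinuous.mk fun S hS h0 ↦ ?_
    have hS' := h S hS
    rw [measureReal_def μ, h0, ENNReal.toReal_zero, zero_mul] at hS'
    exact (measureReal_eq_zero_iff).1 (pow_eq_zero_iff two_ne_zero |>.1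
      (le_antisymm hS' (sq_nonneg _)))
  have hσ : σ ≪ μ + ν := hσμ.trans hμ
  have hquad : ∀ q : ℚ≥0, ∀ᵐ x ∂(μ + ν), 2 * ((q : ℝ≥0) : ℝ≥0∞) * σ.rnDeriv (μ + ν) x ≤
      ((q : ℝ≥0) : ℝ≥0∞) ^ 2 * μ.rnDeriv (μ + ν) x + ν.rnDeriv (μ + ν) x := by
    intro q
    refine ae_le_of_forall_setLIntegral_le_of_sigmaFinite (by fun_prop) fun S hS _ ↦ ?_
    rw [lintegral_add_right _ (by fun_prop), lintegral_const_mul _ (by fun_prop),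
      lintegral_const_mul _ (by fun_prop), Measure.setLIntegral_rnDeriv hσ,
      Measure.setLIntegral_rnDeriv hμ, Measure.setLIntegral_rnDeriv hν,
      ← ofReal_measureReal (μ := σ), ← ofReal_measureReal (μ := μ), ← ofReal_measureReal (μ := ν),
      ← ENNReal.ofReal_coe_nnreal, ← ENNReal.ofReal_ofNat 2, ← ENNReal.ofReal_pow (by positivity),
      ← ENNReal.ofReal_mul (by positivity), ← ENNReal.ofReal_mul (by positivity),
      ← ENNReal.ofReal_mul (by positivity), ← ENNReal.ofReal_add (by positivity) (by positivity)]
    refine ENNReal.ofReal_le_ofReal (abs_le_of_sq_le_sq' ?_ (by positivity)).2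
    nlinarith [mul_le_mul_of_nonneg_left (h S hS) (sq_nonneg (2 * ((q : ℝ≥0) : ℝ))),
      sq_nonneg (((q : ℝ≥0) : ℝ) ^ 2 * μ.real S - ν.real S)]
  rw [← Measure.withDensity_rnDeriv_eq σ (μ + ν) hσ, geomMean]
  refine withDensity_mono ?_
  filter_upwards [ae_all_iff.2 hquad, σ.rnDeriv_ne_top (μ + ν), μ.rnDeriv_ne_top (μ + ν),
    ν.rnDeriv_ne_top (μ + ν)] with x hx hs hu hv
  exact le_sqrt_mul_of_forall_nnrat hs hu hv hx

/-- **Maximality of the geometric mean of measures.**  If `σ` is a positive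
measure such that `|∫ f·conj(g) dσ|² ≤ (∫ |f|² dμ)·(∫ |g|² dν)` for all
bounded measurable `f, g : X → ℂ`, then `σ ≤ √(μν)`; thus the geometric mean
is the largest measure with this property. -/
theorem geomMean_is_largest
    {X : Type*} [MeasurableSpace X] (μ ν σ : Measure X)
    [IsFiniteMeasure μ] [IsFiniteMeasure ν] [IsFiniteMeasure σ]
    (hσ : ∀ f g : X → ℂ, Measurable f → Measurable g →
      (∃ C : ℝ, ∀ x, ‖f x‖ ≤ C) → (∃ C : ℝ, ∀ x, ‖g x‖ ≤ C) →
      ‖∫ x, f x * (starRingEnd ℂ) (g x) ∂σ‖ ^ 2 ≤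
        (∫ x, ‖f x‖ ^ 2 ∂μ) * (∫ x, ‖g x‖ ^ 2 ∂ν)) :
    σ ≤ geomMean μ ν := by
  refine le_geomMean_of_sq_le_mul fun S hS ↦ ?_
  have hmeas : Measurable (S.indicator (1 : X → ℂ)) := measurable_one.indicator hS
  have hbdd : ∃ C : ℝ, ∀ x, ‖S.indicator (1 : X → ℂ) x‖ ≤ C :=
    ⟨1, fun x ↦ by by_cases hx : x ∈ S <;> simp [hx]⟩
  have hprod : (fun x ↦ S.indicator (1 : X → ℂ) x * (starRingEnd ℂ) (S.indicator 1 x)) =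
      S.indicator 1 := by
    ext x
    by_cases hx : x ∈ S <;> simp [hx]
  have hnorm : (fun x ↦ ‖S.indicator (1 : X → ℂ) x‖ ^ 2) = S.indicator 1 := by
    ext x
    by_cases hx : x ∈ S <;> simp [hx]
  have hS' := hσ _ _ hmeas hmeas hbdd hbdd
  rw [hprod, hnorm, integral_indicator_one hS, integral_indicator_one hS,
    integral_indicator hS] at hS'
  simpa using hS'
end

section
/- Let μ_1, …, μ_n be finite positive measures on a measurable space (X, 𝒜) and let f_1, …, f_n : X → ℂ be bounded measurable functions. Then the complex number ∑_{j,k=1}^n ∫_X f_j · conj(f_k) d√(μ_j μ_k) is real and non-negative, where √(μ_j μ_k) denotes the geometric mean of μ_j and μ_k. -/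
open MeasureTheory
open scoped ComplexOrder

/-- The geometric mean may be computed with respect to any measure dominating both arguments. -/
theorem geomMean_eq_withDensity {X : Type*} [MeasurableSpace X] (μ ν κ : Measure X)
    [IsFiniteMeasure μ] [IsFiniteMeasure ν] [SigmaFinite κ] (hμ : μ ≪ κ) (hν : ν ≪ κ) :
    geomMean μ ν = κ.withDensity fun x => (μ.rnDeriv κ x * ν.rnDeriv κ x) ^ (1 / 2 : ℝ) := by
  have hsum : μ + ν ≪ κ := Measure.AbsolutelyContinuous.add_left hμ hν
  have hμs : μ ≪ μ + ν := Measure.le_add_right le_rfl |>.absolutelyContinuous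
  have hνs : ν ≪ μ + ν := Measure.le_add_left le_rfl |>.absolutelyContinuous
  have hmeas : Measurable fun x =>
      (μ.rnDeriv (μ + ν) x * ν.rnDeriv (μ + ν) x) ^ (1 / 2 : ℝ) := by fun_prop
  calc geomMean μ ν
      = (κ.withDensity ((μ + ν).rnDeriv κ)).withDensity
          fun x => (μ.rnDeriv (μ + ν) x * ν.rnDeriv (μ + ν) x) ^ (1 / 2 : ℝ) := by
        rw [Measure.withDensity_rnDeriv_eq _ _ hsum, geomMean]
    _ = κ.withDensity ((μ + ν).rnDeriv κ *
          fun x => (μ.rnDeriv (μ + ν) x * ν.rnDeriv (μ + ν) x) ^ (1 / 2 : ℝ)) :=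
        (withDensity_mul _ (Measure.measurable_rnDeriv _ _) hmeas).symm
    _ = _ := by
        refine withDensity_congr_ae ?_
        filter_upwards [Measure.rnDeriv_mul_rnDeriv (κ := κ) hμs,
          Measure.rnDeriv_mul_rnDeriv (κ := κ) hνs] with x hx hy
        rw [← hx, ← hy]
        simp only [Pi.mul_apply]
        rw [mul_mul_mul_comm, ← sq, mul_comm,
          ENNReal.mul_rpow_of_nonneg (_ * _) (_ ^ 2) (by norm_num : (0 : ℝ) ≤ 1 / 2),
          ← ENNReal.rpow_two, ← ENNReal.rpow_mul]
        norm_num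

/-- A bounded measurable function times the square root of a Radon–Nikodym derivative is
square integrable. -/
theorem memLp_two_sqrt_rnDeriv_mul {X : Type*} [MeasurableSpace X] (μ κ : Measure X)
    [IsFiniteMeasure μ] {f : X → ℂ} (hf : Measurable f) {C : ℝ} (hC : ∀ x, ‖f x‖ ≤ C) :
    MemLp (fun x => (√(μ.rnDeriv κ x).toReal : ℂ) * f x) 2 κ := by
  have hsqrt : MemLp (fun x => √(μ.rnDeriv κ x).toReal) 2 κ := by
    rw [memLp_two_iff_integrable_sq
      (Measure.measurable_rnDeriv μ κ).ennreal_toReal.sqrt.aestronglyMeasurable]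
    simpa only [Real.sq_sqrt ENNReal.toReal_nonneg] using Measure.integrable_toReal_rnDeriv
  refine hsqrt.of_le_mul (c := C)
    ((Complex.measurable_ofReal.comp
      (Measure.measurable_rnDeriv μ κ).ennreal_toReal.sqrt).mul hf).aestronglyMeasurable
    (.of_forall fun x => ?_)
  rw [norm_mul, Complex.norm_real, mul_comm]
  gcongr
  exact hC x

/-- Integration against the geometric mean in terms of densities for a dominating measure. -/
theorem integral_geomMean {X : Type*} [MeasurableSpace X] (μ ν κ : Measure X)
    [IsFiniteMeasure μ] [IsFiniteMeasure ν] [SigmaFinite κ] (hμ : μ ≪ κ) (hν : ν ≪ κ)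
    (f g : X → ℂ) :
    ∫ x, f x * (starRingEnd ℂ) (g x) ∂(geomMean μ ν) =
      ∫ x, ((√(μ.rnDeriv κ x).toReal : ℂ) * f x) *
        (starRingEnd ℂ) ((√(ν.rnDeriv κ x).toReal : ℂ) * g x) ∂κ := by
  have hlt : ∀ᵐ x ∂κ, (μ.rnDeriv κ x * ν.rnDeriv κ x) ^ (1 / 2 : ℝ) < ⊤ := by
    filter_upwards [μ.rnDeriv_lt_top κ, ν.rnDeriv_lt_top κ] with x hx hy
    exact ENNReal.rpow_lt_top_of_nonneg (by norm_num) (ENNReal.mul_lt_top hx hy).ne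
  rw [geomMean_eq_withDensity μ ν κ hμ hν,
    integral_withDensity_eq_integral_toReal_smul (by fun_prop) hlt]
  congr with x
  rw [← ENNReal.toReal_rpow, ← Real.sqrt_eq_rpow, ENNReal.toReal_mul,
    Real.sqrt_mul ENNReal.toReal_nonneg, Complex.real_smul, map_mul, Complex.conj_ofReal]
  push_cast
  ring

/-- **Positive definiteness of the geometric mean pairing.**  For finite
positive measures `μ_1, …, μ_n` and bounded measurable functions
`f_1, …, f_n : X → ℂ`, the sum `∑_{j,k} ∫ f_j·conj(f_k) d√(μ_j μ_k)` is a
real non-negative number (here `0 ≤ ·` is the complex order, which says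
exactly that the sum is real and non-negative). -/
theorem geomMean_positive_definite
    {X : Type*} [MeasurableSpace X] {n : ℕ} (μ : Fin n → Measure X)
    [∀ i, IsFiniteMeasure (μ i)]
    (f : Fin n → X → ℂ) (hf : ∀ i, Measurable (f i))
    (hfb : ∀ i, ∃ C : ℝ, ∀ x, ‖f i x‖ ≤ C) :
    0 ≤ ∑ j, ∑ k, ∫ x, f j x * (starRingEnd ℂ) (f k x) ∂(geomMean (μ j) (μ k)) := by
  set κ : Measure X := ∑ i, μ i
  have hμ (i : Fin n) : μ i ≪ κ :=
    (Finset.single_le_sum (fun _ _ => Measure.zero_le _)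
      (Finset.mem_univ i)).absolutelyContinuous
  set h : Fin n → X → ℂ := fun i x => (√((μ i).rnDeriv κ x).toReal : ℂ) * f i x
  have hh (i : Fin n) : MemLp (h i) 2 κ := by
    obtain ⟨C, hC⟩ := hfb i
    exact memLp_two_sqrt_rnDeriv_mul (μ i) κ (hf i) hC
  have hint (j k : Fin n) : Integrable (fun x => h j x * (starRingEnd ℂ) (h k x)) κ :=
    (hh j).integrable_mul (hh k).star
  have key : ∑ j, ∑ k, ∫ x, f j x * (starRingEnd ℂ) (f k x) ∂(geomMean (μ j) (μ k)) =
      ((∫ x, Complex.normSq (∑ j, h j x) ∂κ : ℝ) : ℂ) := by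
    simp_rw [fun j k => integral_geomMean (μ j) (μ k) κ (hμ j) (hμ k) (f j) (f k)]
    rw [← integral_complex_ofReal]
    simp_rw [← Complex.mul_conj, map_sum, Finset.sum_mul_sum]
    rw [integral_finsetSum _ fun j _ => integrable_finsetSum _ fun k _ => hint j k]
    exact Finset.sum_congr rfl fun j _ => (integral_finsetSum _ fun k _ => hint j k).symm
  rw [key]
  exact Complex.zero_le_real.2 (integral_nonneg fun x => Complex.normSq_nonneg _)
end

section
/- Let a, b : ℕ → ℝ be nonnegative, antitone (decreasing) sequences with finite sum (eigenvalue lists). Suppose the tensor squares of a and b have the same eigenvalue list, in the sense that for every x > 0 the (necessarily finite) sets {(i, j) ∈ ℕ × ℕ : a_i · a_j > x} and {(i, j) ∈ ℕ × ℕ : b_i · b_j > x} have the same cardinality. Then a = b, i.e. a_n = b_n for every n. -/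
/-- Only finitely many products `a i * a j` of a nonnegative summable sequence exceed `x > 0`. -/
theorem finite_setOf_lt_mul {a : ℕ → ℝ} (ha0 : ∀ n, 0 ≤ a n) (haSum : Summable a)
    {x : ℝ} (hx : 0 < x) : {p : ℕ × ℕ | x < a p.1 * a p.2}.Finite := by
  have hsum : Summable fun p : ℕ × ℕ => a p.1 * a p.2 := haSum.mul_of_nonneg haSum ha0 ha0
  have hev := hsum.tendsto_cofinite_zero.eventually (gt_mem_nhds hx)
  refine (Filter.eventually_cofinite.mp hev).subset fun p hp => ?_
  exact not_lt.mpr (le_of_lt hp)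

/-- If `a` and `b` agree below `n` and `b n < a n`, then some threshold is exceeded by strictly
more products of entries of `a` than of entries of `b`. -/
theorem exists_ncard_lt_of_lt {a b : ℕ → ℝ} (ha0 : ∀ n, 0 ≤ a n) (hb0 : ∀ n, 0 ≤ b n)
    (haAnti : Antitone a) (hbAnti : Antitone b) (haSum : Summable a) {n : ℕ}
    (heq : ∀ m < n, a m = b m) (hlt : b n < a n) :
    ∃ x : ℝ, 0 < x ∧
      {p : ℕ × ℕ | x < b p.1 * b p.2}.ncard < {p : ℕ × ℕ | x < a p.1 * a p.2}.ncard := by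
  obtain ⟨t, hbt, hta⟩ := exists_between hlt
  have ht : 0 < t := (hb0 n).trans_lt hbt
  have ha : 0 < a 0 := (ht.trans hta).trans_le (haAnti n.zero_le)
  have hba : b 0 ≤ a 0 := by
    rcases n.eq_zero_or_pos with rfl | hn
    · exact hlt.le
    · exact (heq 0 hn).ge
  have hx : 0 < a 0 * t := mul_pos ha ht
  have hsmall : ∀ i j, n ≤ j → b i * b j < a 0 * t := fun i j hj =>
    calc b i * b j ≤ a 0 * b n :=
          mul_le_mul ((hbAnti i.zero_le).trans hba) (hbAnti hj) (hb0 j) ha.le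
      _ < a 0 * t := mul_lt_mul_of_pos_left hbt ha
  refine ⟨a 0 * t, hx, Set.ncard_lt_ncard ?_ (finite_setOf_lt_mul ha0 haSum hx)⟩
  refine (Set.ssubset_iff_of_subset ?_).mpr ⟨(0, n), ?_, ?_⟩
  · rintro ⟨i, j⟩ hij
    have hij' : a 0 * t < b i * b j := hij
    have hj : j < n := lt_of_not_ge fun h => hij'.not_gt (hsmall i j h)
    have hi : i < n := lt_of_not_ge fun h => hij'.not_gt (mul_comm (b i) (b j) ▸ hsmall j i h)
    simpa only [Set.mem_ofPred_eq, heq i hi, heq j hj] using hij'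
  · exact mul_lt_mul_of_pos_left hta ha
  · exact (hsmall 0 n le_rfl).not_gt

/-- **Eigenvalue lists are determined by their tensor squares.**
Let `a, b : ℕ → ℝ` be nonnegative decreasing sequences with finite sum
(eigenvalue lists).  If their tensor squares have the same eigenvalue list —
i.e. for every `x > 0` the (necessarily finite) sets of pairs `(i, j)` with
`a i · a j > x`, resp. `b i · b j > x`, have the same cardinality — then
`a = b`. -/
theorem eigenvalue_list_determined_by_tensor_square
    (a b : ℕ → ℝ)
    (ha0 : ∀ n, 0 ≤ a n) (hb0 : ∀ n, 0 ≤ b n)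
    (haAnti : Antitone a) (hbAnti : Antitone b)
    (haSum : Summable a) (hbSum : Summable b)
    (hcount : ∀ x : ℝ, 0 < x →
      {p : ℕ × ℕ | x < a p.1 * a p.2}.ncard = {p : ℕ × ℕ | x < b p.1 * b p.2}.ncard) :
    a = b := by
  by_contra hne
  have hex : ∃ n, a n ≠ b n := Function.ne_iff.mp hne
  classical
  have heq : ∀ m < Nat.find hex, a m = b m := fun m hm => not_not.mp (Nat.find_min hex hm)
  rcases (Nat.find_spec hex).lt_or_gt with h | h
  · obtain ⟨x, hx, hlt⟩ := exists_ncard_lt_of_lt hb0 ha0 hbAnti haAnti hbSum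
      (fun m hm => (heq m hm).symm) h
    exact hlt.ne (hcount x hx)
  · obtain ⟨x, hx, hlt⟩ := exists_ncard_lt_of_lt ha0 hb0 haAnti hbAnti haSum heq h
    exact hlt.ne' (hcount x hx)
end
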